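/- Let R = k[x_1,…,x_n] be a standard graded polynomial ring over an infinite field, let M be a finitely generated graded R-module of dimension d with dimension filtration {δ_j}, and let i ∈ {0,…,d}. If M is i-partially sequentially Cohen-Macaulay, then: (1) H^j_m(M) ≅ H^j_m(δ_j) ≅ H^j_m(δ_j/δ_{j-1}) for all j ≥ i; and (2) the Hilbert series satisfy (z−1)^j · Hilb(H^j_m(M)) = (1−z)^j · Hilb(δ_j/δ_{j-1}) for all j ≥ i. -/

import Mathlib

open CategoryTheory

noncomputable section

/-- The (Krull) dimension of a module: the Krull dimension of its support.
The dimension of the zero module is `⊥` (thought of as `-1`). -/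
noncomputable def mDim (R : Type) [CommRing R] (M : Type) [AddCommGroup M] [Module R M] :
    WithBot ℕ∞ :=
  Order.krullDim (Module.support R M)

/-- The `i`-th Ext module `Ext_R^i(A, B)` (as a type). -/
noncomputable abbrev extC (R : Type) [CommRing R] (i : ℕ) (A B : Type)
    [AddCommGroup A] [Module R A] [AddCommGroup B] [Module R B] : Type :=
  ↥(((Ext R (ModuleCat R) i).obj (Opposite.op (ModuleCat.of R A))).obj (ModuleCat.of R B))

/-- The depth of a module `M` with respect to an ideal `I`:
the least `i` such that `Ext_R^i(R/I, M) ≠ 0` (and `⊤` if there is no such `i`,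
in particular the depth of the zero module is `⊤ = +∞`). -/
noncomputable def mDepth (R : Type) [CommRing R] (I : Ideal R) (M : Type)
    [AddCommGroup M] [Module R M] : ℕ∞ :=
  sInf {i : ℕ∞ | ∃ j : ℕ, i = j ∧ Nontrivial (extC R j (R ⧸ I) M)}

/-- `M` is a Cohen-Macaulay module (with respect to the (maximal) ideal `I`) if it is
nonzero and its depth equals its dimension. -/
def IsCM (R : Type) [CommRing R] (I : Ideal R) (M : Type) [AddCommGroup M] [Module R M] :
    Prop :=
  Nontrivial M ∧ (mDepth R I M : WithBot ℕ∞) = mDim R M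

/-- The subquotient `N'/N` of a module (most meaningful when `N ≤ N'`). -/
abbrev subQuot (R : Type) [CommRing R] {M : Type} [AddCommGroup M] [Module R M]
    (N N' : Submodule R M) : Type :=
  N' ⧸ (Submodule.comap N'.subtype N)

/-- `F 0 = 0 ⊊ F 1 ⊊ ⋯ ⊊ F r = M` is a sCM filtration: each quotient `F (i+1) / F i`
is Cohen-Macaulay and the dimensions of the quotients are strictly increasing. -/
def IsSCMFil (R : Type) [CommRing R] (I : Ideal R) {M : Type} [AddCommGroup M] [Module R M]
    (r : ℕ) (F : ℕ → Submodule R M) : Prop :=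
  F 0 = ⊥ ∧ F r = ⊤ ∧ (∀ i < r, F i < F (i + 1)) ∧
    (∀ i < r, IsCM R I (subQuot R (F i) (F (i + 1)))) ∧
    (∀ i, i + 1 < r →
      mDim R (subQuot R (F i) (F (i + 1))) < mDim R (subQuot R (F (i + 1)) (F (i + 2))))

/-- `M` is sequentially Cohen-Macaulay if it admits a sCM filtration. -/
def IsSeqCM (R : Type) [CommRing R] (I : Ideal R) (M : Type) [AddCommGroup M] [Module R M] :
    Prop :=
  ∃ (r : ℕ) (F : ℕ → Submodule R M), IsSCMFil R I r F

/-- `δ_c(M)`: the largest submodule of `M` of dimension at most `c`. -/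
noncomputable def deltaSub (R : Type) [CommRing R] (M : Type) [AddCommGroup M] [Module R M]
    (c : ℕ) : Submodule R M :=
  sSup {N : Submodule R M | mDim R ↥N ≤ (c : WithBot ℕ∞)}

/-- `δ_{c-1}(M)`, with `δ_{-1}(M) = 0`. -/
noncomputable def deltaSubPred (R : Type) [CommRing R] (M : Type) [AddCommGroup M] [Module R M] :
    ℕ → Submodule R M
  | 0 => ⊥
  | (c + 1) => deltaSub R M c

/-- `H^0_I(M)`, the `I`-power-torsion submodule of `M`. -/
noncomputable def tors (R : Type) [CommRing R] (I : Ideal R) (M : Type) [AddCommGroup M]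
    [Module R M] : Submodule R M :=
  ⨆ t : ℕ, Submodule.torsionBySet R M ((I ^ t : Ideal R) : Set R)

end
noncomputable section

/-- The homogeneous maximal (irrelevant) ideal `𝔪 = (x_1, …, x_n)` of `k[x_1, …, x_n]`. -/
noncomputable def irrIdeal (k : Type) [Field k] (n : ℕ) : Ideal (MvPolynomial (Fin n) k) :=
  Ideal.span (Set.range MvPolynomial.X)

/-- The linear form with coefficients `a : Fin n → k`. -/
noncomputable def linForm (k : Type) [Field k] (n : ℕ) (a : Fin n → k) :
    MvPolynomial (Fin n) k :=
  ∑ i : Fin n, MvPolynomial.C (a i) * MvPolynomial.X i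

/-- Given a ℤ-graded module `M` over `k[x_1, …, x_n]` with grading `𝒜`, a submodule `N` is
graded (homogeneous) if it is spanned by its homogeneous elements. -/
def IsGradedSub (k : Type) [Field k] (n : ℕ) (M : Type) [AddCommGroup M]
    [Module (MvPolynomial (Fin n) k) M] [Module k M]
    [IsScalarTower k (MvPolynomial (Fin n) k) M]
    (𝒜 : ℤ → Submodule k M) (N : Submodule (MvPolynomial (Fin n) k) M) : Prop :=
  N.restrictScalars k ≤ ⨆ e : ℤ, (N.restrictScalars k ⊓ 𝒜 e)

/-- `δ_c(M/N)`: the largest graded submodule of `M/N` of dimension at most `c`, encoded as a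
submodule of `M` containing `N`. -/
noncomputable def deltaPairG (k : Type) [Field k] (n : ℕ) (M : Type) [AddCommGroup M]
    [Module (MvPolynomial (Fin n) k) M] [Module k M]
    [IsScalarTower k (MvPolynomial (Fin n) k) M]
    (𝒜 : ℤ → Submodule k M) (N : Submodule (MvPolynomial (Fin n) k) M) (c : ℕ) :
    Submodule (MvPolynomial (Fin n) k) M :=
  sSup {P | N ≤ P ∧ IsGradedSub k n M 𝒜 P ∧
    mDim (MvPolynomial (Fin n) k) (subQuot (MvPolynomial (Fin n) k) N P) ≤ (c : WithBot ℕ∞)}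

/-- `δ_{c-1}(M/N)`, with the convention `δ_{-1} = 0` (i.e. `N` as a submodule of `M`). -/
noncomputable def deltaPairGPred (k : Type) [Field k] (n : ℕ) (M : Type) [AddCommGroup M]
    [Module (MvPolynomial (Fin n) k) M] [Module k M]
    [IsScalarTower k (MvPolynomial (Fin n) k) M]
    (𝒜 : ℤ → Submodule k M) (N : Submodule (MvPolynomial (Fin n) k) M) :
    ℕ → Submodule (MvPolynomial (Fin n) k) M
  | 0 => N
  | (c + 1) => deltaPairG k n M 𝒜 N c

/-- The quotient `M/N` (of the graded module `M` by a graded submodule `N`) is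
`i`-partially sequentially Cohen-Macaulay: the quotients `δ_j/δ_{j-1}` of its dimension
filtration (by largest graded submodules of dimension `≤ j`) are zero or Cohen-Macaulay
for all `j ≥ i`. -/
noncomputable def IsPartiallySCM (k : Type) [Field k] (n : ℕ) (M : Type) [AddCommGroup M]
    [Module (MvPolynomial (Fin n) k) M] [Module k M]
    [IsScalarTower k (MvPolynomial (Fin n) k) M]
    (𝒜 : ℤ → Submodule k M) (N : Submodule (MvPolynomial (Fin n) k) M) (i : ℕ) : Prop :=
  ∀ j : ℕ, i ≤ j →
    Subsingleton (subQuot (MvPolynomial (Fin n) k)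
      (deltaPairGPred k n M 𝒜 N j) (deltaPairG k n M 𝒜 N j)) ∨
    IsCM (MvPolynomial (Fin n) k) (irrIdeal k n)
      (subQuot (MvPolynomial (Fin n) k)
        (deltaPairGPred k n M 𝒜 N j) (deltaPairG k n M 𝒜 N j))

end
noncomputable section
/-- The `j`-th local cohomology module `H^j_𝔪(A)` of a module `A` over `k[x_1, …, x_n]`,
with support in the homogeneous maximal ideal `𝔪`, as a type. -/
noncomputable abbrev locCoh (k : Type) [Field k] (n : ℕ) (j : ℕ) (A : Type) [AddCommGroup A]
    [Module (MvPolynomial (Fin n) k) A] : Type :=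
  ↥((localCohomology (irrIdeal k n) j).obj (ModuleCat.of (MvPolynomial (Fin n) k) A))
end
/-- A presentation of the module `N` as a ℤ-graded module over `k[x_1, …, x_n]`:
a graded module `V` (with finite dimensional graded pieces, of dimensions `hdim`)
isomorphic to `N`.  This is used to speak about the Hilbert series of local cohomology
modules. -/
structure GradedRep (k : Type) [Field k] (n : ℕ) (N : Type) [AddCommGroup N]
    [Module (MvPolynomial (Fin n) k) N] where
  V : Type
  [acg : AddCommGroup V]
  [modS : Module (MvPolynomial (Fin n) k) V]
  [modk : Module k V]
  [tower : IsScalarTower k (MvPolynomial (Fin n) k) V]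
  iso : V ≃ₗ[MvPolynomial (Fin n) k] N
  piece : ℤ → Submodule k V
  internal : DirectSum.IsInternal piece
  compat : ∀ (d : ℕ) (f : MvPolynomial (Fin n) k), f.IsHomogeneous d →
    ∀ (e : ℤ), ∀ x ∈ piece e, f • x ∈ piece (e + (d : ℤ))
  findim : ∀ e : ℤ, FiniteDimensional k (piece e)
  hdim : ℤ → ℕ
  hdim_spec : ∀ e : ℤ, Module.finrank k (piece e) = hdim e


noncomputable section
namespace St15
open Limits
set_option linter.unusedVariables false

variable {R : Type} [CommRing R]

abbrev AE (X Y : ModuleCat.{0} R) (j : ℕ) : Type := Abelian.Ext.{0} X Y j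

variable {X Y : ModuleCat.{0} R} (P : ProjectiveResolution X)

lemma extMk_zero_inj (f : P.complex.X 0 ⟶ Y) (hf : P.complex.d 1 0 ≫ f = 0)
    (h : P.extMk f 1 rfl hf = 0) : f = 0 := by
  rw [← P.extEquivCohomologyClass.apply_eq_iff_eq, P.extEquivCohomologyClass_extMk,
    P.extEquivCohomologyClass_zero, CochainComplex.HomComplex.CohomologyClass.mk_eq_zero_iff,
    CochainComplex.HomComplex.Cocycle.toSingleMk_mem_coboundaries_iff _ _ _ _ _ 1 (by simp)] at h
  obtain ⟨g, hg⟩ := h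
  have hz : IsZero (P.cochainComplex.X 1) := 
    P.cochainComplex.isZero_of_isStrictlyLE 0 1
  rw [hz.eq_of_src g 0, comp_zero] at hg
  rw [← cancel_epi (P.cochainComplexXIso (-(0:ℕ)) 0 rfl).hom, comp_zero]
  exact hg.symm

lemma extMk_smul (r : R) {j : ℕ} (f : P.complex.X j ⟶ Y) (m : ℕ) (hm : j + 1 = m)
    (hf : P.complex.d m j ≫ f = 0) :
    P.extMk (r • f) m hm (by simp [hf]) = r • P.extMk f m hm hf := by
  rw [Abelian.Ext.smul_eq_comp_mk₀, P.extMk_comp_mk₀]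
  congr 1

/-- cocycles -/
def cocyc (Y : ModuleCat.{0} R) (j : ℕ) : Submodule R (P.complex.X j ⟶ Y) where
  carrier := {f | P.complex.d (j+1) j ≫ f = 0}
  add_mem' := by intro a b ha hb; simp only [Set.mem_ofPred_eq] at *; simp [ha, hb]
  zero_mem' := by simp
  smul_mem' := by intro c x hx; simp only [Set.mem_ofPred_eq] at *; simp [hx]

def newMk (Y : ModuleCat.{0} R) (j : ℕ) : cocyc P Y j →ₗ[R] AE X Y j where
  toFun f := P.extMk f.1 (j+1) rfl f.2
  map_add' f g := (P.add_extMk _ _ _ _ _ _).symm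
  map_smul' r f := extMk_smul P r _ _ _ _

lemma newMk_surj (j : ℕ) : Function.Surjective (newMk P Y j) := by
  intro a
  obtain ⟨f, hf, rfl⟩ := P.extMk_surjective a (j+1) rfl
  exact ⟨⟨f, hf⟩, rfl⟩

/-- is a coboundary -/
def IsCob (j : ℕ) (f : P.complex.X j ⟶ Y) : Prop :=
  ∃ g : P.complex.X ((ComplexShape.up ℕ).prev j) ⟶ Y, 
    P.complex.d j ((ComplexShape.up ℕ).prev j) ≫ g = f

lemma newMk_eq_zero (j : ℕ) (f : cocyc P Y j) : newMk P Y j f = 0 ↔ IsCob P j f.1 := by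
  cases j with
  | zero => 
    have : P.complex.d 0 ((ComplexShape.up ℕ).prev 0) = 0 := by
      apply P.complex.shape; simp
    constructor
    · intro h
      have := extMk_zero_inj P f.1 f.2 h
      exact ⟨0, by simp [this]⟩
    · rintro ⟨g, hg⟩
      rw [this, zero_comp] at hg
      have : f = 0 := Subtype.ext hg.symm
      rw [this, map_zero]
  | succ p =>
    have hp : (ComplexShape.up ℕ).prev (p+1) = p := by simp
    refine (P.extMk_eq_zero_iff f.1 (p+1+1) rfl f.2 p rfl).trans ?_
    unfold IsCob
    rw [hp]

abbrev KK (Y : ModuleCat.{0} R) := P.complex.linearYonedaObj R Y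

def homMk (Y : ModuleCat.{0} R) (j : ℕ) : cocyc P Y j →ₗ[R] (KK P Y).homology j :=
  ((KK P Y).homologyπ j).hom ∘ₗ
    ((KK P Y).liftCycles (k := 
      (ModuleCat.ofHom (cocyc P Y j).subtype : ModuleCat.of R (cocyc P Y j) ⟶ (KK P Y).X j))
       (j+1) (by simp) (by
        ext f
        exact f.2)).hom

lemma homMk_surj (j : ℕ) : Function.Surjective (homMk P Y j) := by
  intro a
  obtain ⟨z, rfl⟩ := (ModuleCat.epi_iff_surjective ((KK P Y).homologyπ j)).1 inferInstance a
  refine ⟨⟨(KK P Y).iCycles j z, ?_⟩, ?_⟩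
  · have := congrArg (fun f => f.hom z) ((KK P Y).iCycles_d j (j+1))
    exact this
  · unfold homMk
    rw [LinearMap.comp_apply]
    congr 1
    apply (ModuleCat.mono_iff_injective ((KK P Y).iCycles j)).1 inferInstance
    rw [← ModuleCat.comp_apply]
    erw [(KK P Y).liftCycles_i]
    rfl

lemma homMk_eq_zero (j : ℕ) (f : cocyc P Y j) : homMk P Y j f = 0 ↔ IsCob P j f.1 := by
  let S := ShortComplex.mk _ _ ((KK P Y).toCycles_comp_homologyπ ((ComplexShape.up ℕ).prev j) j)
  have hc : S.Exact := ShortComplex.exact_of_g_is_cokernel _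
    ((KK P Y).homologyIsCokernel _ j rfl)
  rw [ShortComplex.moduleCat_exact_iff] at hc
  have hl : (KK P Y).iCycles j (((KK P Y).liftCycles (k := 
      (ModuleCat.ofHom (cocyc P Y j).subtype : ModuleCat.of R (cocyc P Y j) ⟶ (KK P Y).X j))
       (j+1) (by simp) (by
        ext f
        exact f.2)).hom f) = f.1 := by
    rw [← ModuleCat.comp_apply]
    erw [(KK P Y).liftCycles_i]
    rfl
  constructor
  · intro h
    obtain ⟨g, hg⟩ := hc _ h
    refine ⟨g, ?_⟩
    rw [← hl, ← hg]
    have := congrArg (fun f => f.hom g) ((KK P Y).toCycles_i ((ComplexShape.up ℕ).prev j) j)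
    exact this.symm
  · rintro ⟨g, hg⟩
    have h2 := congrArg (fun f => f.hom g) ((KK P Y).toCycles_comp_homologyπ ((ComplexShape.up ℕ).prev j) j)
    refine Eq.trans ?_ h2
    unfold homMk
    rw [LinearMap.comp_apply]
    refine congrArg ((KK P Y).homologyπ j).hom
      (?_ : _ = ((KK P Y).toCycles ((ComplexShape.up ℕ).prev j) j).hom g)
    apply (ModuleCat.mono_iff_injective ((KK P Y).iCycles j)).1 inferInstance
    refine hl.trans ?_
    rw [← hg]
    have := congrArg (fun f => f.hom g) ((KK P Y).toCycles_i ((ComplexShape.up ℕ).prev j) j)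
    exact this.symm

section
variable {A B C : Type} [AddCommGroup A] [Module R A] [AddCommGroup B] [Module R B]
  [AddCommGroup C] [Module R C]

/-- two surjections with the same kernel -/
def equivOfSurj (f : A →ₗ[R] B) (g : A →ₗ[R] C) (hf : Function.Surjective f)
    (hg : Function.Surjective g) (h : ∀ a, f a = 0 ↔ g a = 0) : B ≃ₗ[R] C :=
  (f.quotKerEquivOfSurjective hf).symm ≪≫ₗ
    (Submodule.quotEquivOfEq _ _ (by ext a; simpa using h a)) ≪≫ₗ
    (g.quotKerEquivOfSurjective hg)

lemma equivOfSurj_apply (f : A →ₗ[R] B) (g : A →ₗ[R] C) (hf : Function.Surjective f)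
    (hg : Function.Surjective g) (h : ∀ a, f a = 0 ↔ g a = 0) (a : A) :
    equivOfSurj f g hf hg h (f a) = g a := by
  unfold equivOfSurj
  simp only [LinearEquiv.trans_apply]
  have : (f.quotKerEquivOfSurjective hf).symm (f a) = Submodule.Quotient.mk a := by
    rw [LinearEquiv.symm_apply_eq]; rfl
  rw [this]
  rfl
end

abbrev OE (X Y : ModuleCat.{0} R) (j : ℕ) : ModuleCat R :=
  ((Ext R (ModuleCat.{0} R) j).obj (Opposite.op X)).obj Y

def oldMk (Y : ModuleCat.{0} R) (j : ℕ) : cocyc P Y j →ₗ[R] OE X Y j :=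
  (P.isoExt (R := R) j Y).inv.hom ∘ₗ homMk P Y j

def cmp (Y : ModuleCat.{0} R) (j : ℕ) : OE X Y j ≃ₗ[R] AE X Y j :=
  equivOfSurj (oldMk P Y j) (newMk P Y j)
    (by
      have h1 := (ModuleCat.epi_iff_surjective (P.isoExt (R := R) j Y).inv).1 inferInstance
      have h2 := homMk_surj (Y := Y) P j
      intro b
      obtain ⟨c, rfl⟩ := h1 b
      obtain ⟨d, rfl⟩ := h2 c
      exact ⟨d, rfl⟩)
    (newMk_surj P j)
    (fun a => by
      rw [newMk_eq_zero, ← homMk_eq_zero]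
      unfold oldMk
      rw [LinearMap.comp_apply]
      exact map_eq_zero_iff (P.isoExt (R := R) j Y).inv.hom
        ((ModuleCat.mono_iff_injective (P.isoExt (R := R) j Y).inv).1 inferInstance))

lemma cmp_oldMk (j : ℕ) (f : cocyc P Y j) : cmp P Y j (oldMk P Y j f) = newMk P Y j f :=
  equivOfSurj_apply _ _ _ _ _ _

variable {P} {X' : ModuleCat.{0} R} {P' : ProjectiveResolution X'} {g : X' ⟶ X}

def cocycMap (φ : ProjectiveResolution.Hom P' P g) (j : ℕ) (f : cocyc P Y j) : cocyc P' Y j :=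
  ⟨φ.hom.f j ≫ f.1, by
    have := f.2
    change P.complex.d (j+1) j ≫ f.1 = 0 at this
    change P'.complex.d (j+1) j ≫ _ = 0
    rw [← Category.assoc, ← φ.hom.comm, Category.assoc, this, comp_zero]⟩

def yMap (Y : ModuleCat.{0} R) (φ : P'.complex ⟶ P.complex) : KK P Y ⟶ KK P' Y where
  f i := ModuleCat.ofHom 
    { toFun := fun (f : P.complex.X i ⟶ Y) => φ.f i ≫ f
      map_add' := by intros; simp
      map_smul' := by intros; simp }
  comm' i j _ := by
    ext (f : P.complex.X i ⟶ Y)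
    change P'.complex.d j i ≫ φ.f i ≫ f = φ.f j ≫ P.complex.d j i ≫ f
    simp

lemma homMk_nat (φ : ProjectiveResolution.Hom P' P g) (j : ℕ) (f : cocyc P Y j) :
    HomologicalComplex.homologyMap (yMap Y φ.hom) j (homMk P Y j f) = homMk P' Y j (cocycMap φ j f) := by
  unfold homMk
  simp only [LinearMap.comp_apply]
  have h1 := congrArg (fun f => f.hom) (HomologicalComplex.homologyπ_naturality (yMap Y φ.hom) j)
  simp only [ModuleCat.hom_comp] at h1
  refine (LinearMap.congr_fun h1 _).trans ?_
  rw [LinearMap.comp_apply]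
  congr 1
  apply (ModuleCat.mono_iff_injective ((KK P' Y).iCycles j)).1 inferInstance
  have h2 := congrArg (fun f => f.hom) (HomologicalComplex.cyclesMap_i (yMap Y φ.hom) j)
  simp only [ModuleCat.hom_comp] at h2
  refine (LinearMap.congr_fun h2 _).trans ?_
  rw [LinearMap.comp_apply]
  have h3 := congrArg (fun f => f.hom) ((KK P Y).liftCycles_i (k := 
      (ModuleCat.ofHom (cocyc P Y j).subtype : ModuleCat.of R (cocyc P Y j) ⟶ (KK P Y).X j))
       (j+1) (by simp) (by
        ext f
        exact f.2))
  have h4 := congrArg (fun f => f.hom) ((KK P' Y).liftCycles_i (k := 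
      (ModuleCat.ofHom (cocyc P' Y j).subtype : ModuleCat.of R (cocyc P' Y j) ⟶ (KK P' Y).X j))
       (j+1) (by simp) (by
        ext f
        exact f.2))
  simp only [ModuleCat.hom_comp] at h3 h4
  refine Eq.trans ?_ (LinearMap.congr_fun h4 _).symm
  refine (congrArg ((yMap Y φ.hom).f j).hom (LinearMap.congr_fun h3 _)).trans ?_
  rfl

lemma abs_nat {C : Type*} [Category C] {A A' B B' D D' : C} (u : A ⟶ A') (p : A ⟶ B)
    (p' : A' ⟶ B') (m : B ⟶ B') (e : D ≅ B) (e' : D' ≅ B') (h : D ⟶ D')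
    (h1 : u ≫ p' = p ≫ m) (h2 : e.hom ≫ m = h ≫ e'.hom) :
    u ≫ p' ≫ e'.inv = (p ≫ e.inv) ≫ h := by
  rw [← Category.assoc, h1, Category.assoc, Category.assoc]
  congr 1
  rw [Iso.comp_inv_eq, Category.assoc, Iso.eq_inv_comp, h2]

lemma isoExt_nat (φ : ProjectiveResolution.Hom P' P g) (j : ℕ) :
    ((Ext R (ModuleCat.{0} R) j).map g.op).app Y ≫ (P'.isoExt (R := R) j Y).hom =
      (P.isoExt j Y).hom ≫ HomologicalComplex.homologyMap (yMap Y φ.hom) j := by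
  let F := ((linearYoneda R (ModuleCat.{0} R)).obj Y).rightOp
  have h1 := ProjectiveResolution.isoLeftDerivedObj_inv_naturality g P' P φ.hom
    (by simpa using φ.hom_f_zero_comp_π_f_zero) F j
  have h2 := HomologicalComplex.homologyOp_hom_naturality (yMap Y φ.hom) j
  have h1' := congrArg Quiver.Hom.unop h1
  have h2' := congrArg Quiver.Hom.unop h2
  exact abs_nat ((F.leftDerived j).map g).unop (P.isoLeftDerivedObj F j).inv.unop
    (P'.isoLeftDerivedObj F j).inv.unop _ ((KK P Y).homologyOp j).unop
    ((KK P' Y).homologyOp j).unop _ h1' h2'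

lemma oldMk_nat (φ : ProjectiveResolution.Hom P' P g) (j : ℕ) (f : cocyc P Y j) :
    (((Ext R (ModuleCat.{0} R) j).map g.op).app Y).hom (oldMk P Y j f) =
      oldMk P' Y j (cocycMap φ j f) := by
  apply (ModuleCat.mono_iff_injective (P'.isoExt (R := R) j Y).hom).1 inferInstance
  have h1 := congrArg (fun u => u.hom (oldMk P Y j f)) (isoExt_nat (Y := Y) φ j)
  refine h1.trans ?_
  have h2 : ∀ {X : ModuleCat R} (P : ProjectiveResolution X) (f : cocyc P Y j),
    (P.isoExt (R := R) j Y).hom.hom (oldMk P Y j f) = homMk P Y j f := by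
    intro X P f
    exact congrArg (fun u => u.hom (homMk P Y j f)) ((P.isoExt (R := R) j Y).inv_hom_id)
  refine Eq.trans ?_ (h2 P' _).symm
  rw [← homMk_nat]
  exact congrArg _ (h2 P f)

lemma cmp_nat (φ : ProjectiveResolution.Hom P' P g) (j : ℕ) (a : OE X Y j) :
    cmp P' Y j ((((Ext R (ModuleCat.{0} R) j).map g.op).app Y).hom a) =
      (Abelian.Ext.mk₀ g).comp (cmp P Y j a) (zero_add j) := by
  obtain ⟨f, rfl⟩ : ∃ f, oldMk P Y j f = a := by
    obtain ⟨f, hf⟩ := newMk_surj P j (cmp P Y j a)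
    refine ⟨f, (cmp P Y j).injective ?_⟩
    rw [cmp_oldMk, hf]
  rw [oldMk_nat φ, cmp_oldMk, cmp_oldMk]
  exact (ProjectiveResolution.mk₀_comp_extMk f.1 (j+1) rfl f.2 φ).symm

/-- the comparison of the two models of Ext -/
def cmpE (X Y : ModuleCat.{0} R) (j : ℕ) : OE X Y j ≃ₗ[R] AE X Y j :=
  cmp (ProjectiveResolution.of X) Y j

lemma cmpE_nat (g : X' ⟶ X) (j : ℕ) (a : OE X Y j) :
    cmpE X' Y j ((((Ext R (ModuleCat.{0} R) j).map g.op).app Y).hom a) =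
      (Abelian.Ext.mk₀ g).comp (cmpE X Y j a) (zero_add j) :=
  cmp_nat ⟨ProjectiveResolution.lift g _ _, by
    have := ProjectiveResolution.lift_commutes g (ProjectiveResolution.of X') (ProjectiveResolution.of X)
    exact congrArg (fun u => u.f 0) this⟩ j a

end St15
end


noncomputable section
namespace St15
open Limits
set_option linter.unusedVariables false
set_option linter.unusedSectionVars false
set_option linter.unusedSimpArgs false

section DL
variable {R : Type} [CommRing R]
  {G G' G'' : ℕ → Type}
  [∀ i, AddCommGroup (G i)] [∀ i, Module R (G i)]
  [∀ i, AddCommGroup (G' i)] [∀ i, Module R (G' i)]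
  [∀ i, AddCommGroup (G'' i)] [∀ i, Module R (G'' i)]
  (f : ∀ i j, i ≤ j → G i →ₗ[R] G j) [DirectedSystem G fun i j h ↦ f i j h]
  (f' : ∀ i j, i ≤ j → G' i →ₗ[R] G' j) [DirectedSystem G' fun i j h ↦ f' i j h]
  (f'' : ∀ i j, i ≤ j → G'' i →ₗ[R] G'' j) [DirectedSystem G'' fun i j h ↦ f'' i j h]

lemma dl_exact (a : ∀ i, G i →ₗ[R] G' i) (ha) (b : ∀ i, G' i →ₗ[R] G'' i) (hb)
    (h : ∀ i y, b i y = 0 → ∃ x, a i x = y) (y : Module.DirectLimit G' f')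
    (hy : Module.DirectLimit.map (f := f') (f' := f'') b hb y = 0) :
    ∃ x, Module.DirectLimit.map (f := f) (f' := f') a ha x = y := by
  obtain ⟨i, y, rfl⟩ := Module.DirectLimit.exists_of y
  rw [Module.DirectLimit.map_apply_of] at hy
  obtain ⟨j, hij, hj⟩ := Module.DirectLimit.of.zero_exact hy
  have h2 : b j (f' i j hij y) = 0 := by
    rw [← hj]; exact LinearMap.congr_fun (hb i j hij) y
  obtain ⟨x, hx⟩ := h j _ h2
  refine ⟨Module.DirectLimit.of R ℕ G f j x, ?_⟩
  rw [Module.DirectLimit.map_apply_of, hx, Module.DirectLimit.of_f]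
end DL

variable {R : Type} [CommRing R] (m : Ideal R)

abbrev Qt (t : ℕ) : ModuleCat.{0} R := ModuleCat.of R (R ⧸ m ^ t)

def trQ {s t : ℕ} (h : s ≤ t) : Qt m t ⟶ Qt m s :=
  ModuleCat.ofHom (Submodule.mapQ _ _ LinearMap.id (Ideal.pow_le_pow_right h))

lemma trQ_self (s : ℕ) : trQ m (le_refl s) = 𝟙 _ := by
  apply ModuleCat.hom_ext
  apply Submodule.linearMap_qext
  rfl

lemma trQ_comp {s t u : ℕ} (h : s ≤ t) (h' : t ≤ u) :
    trQ m h' ≫ trQ m h = trQ m (h.trans h') := by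
  apply ModuleCat.hom_ext
  apply Submodule.linearMap_qext
  rfl

section
variable (N : Type) [AddCommGroup N] [Module R N] (j : ℕ)

def preQ (s t : ℕ) (h : s ≤ t) : AE (Qt m s) (ModuleCat.of R N) j →ₗ[R] AE (Qt m t) (ModuleCat.of R N) j :=
  (Abelian.Ext.mk₀ (trQ m h)).precompOfLinear R _ (zero_add j)

lemma preQ_apply (s t : ℕ) (h : s ≤ t) (x) : preQ m N j s t h x = 
  (Abelian.Ext.mk₀ (trQ m h)).comp x (zero_add j) := rfl

instance : DirectedSystem (fun t => AE (Qt m t) (ModuleCat.of R N) j) (fun s t h => preQ m N j s t h) where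
  map_self := by intro i x; rw [preQ_apply, trQ_self]; simp
  map_map := by 
    intro k j i h h' x
    rw [preQ_apply, preQ_apply, preQ_apply, ← trQ_comp m h h', ← Abelian.Ext.mk₀_comp_mk₀,
      Abelian.Ext.comp_assoc_of_second_deg_zero]

/-- local cohomology with the new Ext -/
abbrev SS : Type := Module.DirectLimit (fun t => AE (Qt m t) (ModuleCat.of R N) j) (preQ m N j)

abbrev sOf (t : ℕ) : AE (Qt m t) (ModuleCat.of R N) j →ₗ[R] SS m N j := 
  Module.DirectLimit.of R ℕ (fun t => AE (Qt m t) (ModuleCat.of R N) j) (preQ m N j) t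

end

section
variable {A B C : Type} [AddCommGroup A] [Module R A] [AddCommGroup B] [Module R B]
  [AddCommGroup C] [Module R C] (j : ℕ) 

def sMap (f : A →ₗ[R] B) : SS m A j →ₗ[R] SS m B j :=
  Module.DirectLimit.map (fun t => (Abelian.Ext.mk₀ (ModuleCat.ofHom f)).postcompOfLinear R _ (add_zero j))
   (by
    intro s t h
    ext x
    exact Abelian.Ext.comp_assoc_of_third_deg_zero _ _ _ (zero_add _))

lemma sMap_of (f : A →ₗ[R] B) (t : ℕ) (x) : sMap m j f (sOf m A j t x) = sOf m B j t
  (x.comp (Abelian.Ext.mk₀ (ModuleCat.ofHom f)) (add_zero j)) := 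
  Module.DirectLimit.map_apply_of _ _ _

lemma ss_ind {P : SS m A j → Prop} (h : ∀ t x, P (sOf m A j t x)) (y) : P y := by
  obtain ⟨i, y, rfl⟩ := Module.DirectLimit.exists_of y
  exact h _ _

lemma sMap_id (y) : sMap m j (LinearMap.id : A →ₗ[R] A) y = y := by
  induction y using ss_ind with | h t x =>
  rw [sMap_of]
  congr 1
  exact Abelian.Ext.comp_mk₀_id x

lemma sMap_smul_id (r : R) (y) : sMap m j (r • LinearMap.id : A →ₗ[R] A) y = r • y := by
  induction y using ss_ind with | h t x =>
  rw [sMap_of, ← map_smul, Abelian.Ext.smul_eq_comp_mk₀]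
  rfl

lemma sMap_comp (f : A →ₗ[R] B) (g : B →ₗ[R] C) (y) : sMap m j g (sMap m j f y) = sMap m j (g ∘ₗ f) y := by
  induction y using ss_ind with | h t x =>
  rw [sMap_of, sMap_of, sMap_of, Abelian.Ext.comp_assoc_of_third_deg_zero, Abelian.Ext.mk₀_comp_mk₀]
  rfl

def sCongr (e : A ≃ₗ[R] B) : SS m A j ≃ₗ[R] SS m B j :=
  LinearEquiv.ofLinearMap (sMap m j e.toLinearMap) (sMap m j e.symm.toLinearMap)
    (by refine LinearMap.ext fun y => ?_; rw [LinearMap.comp_apply, sMap_comp]; simp [sMap_id]) 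
    (by refine LinearMap.ext fun y => ?_; rw [LinearMap.comp_apply, sMap_comp]; simp [sMap_id])

lemma sMap_zero (y) : sMap m j (0 : A →ₗ[R] B) y = 0 := by
  induction y using ss_ind with | h t x =>
  rw [sMap_of]
  have : ModuleCat.ofHom (0 : A →ₗ[R] B) = 0 := rfl
  rw [this, Abelian.Ext.mk₀_zero, Abelian.Ext.comp_zero, map_zero]

variable {f : A →ₗ[R] B} {g : B →ₗ[R] C} (hf : Function.Injective f) (hg : Function.Surjective g)
  (hfg : Function.Exact f g)

include hf hg hfg in
lemma mkSE : (ShortComplex.mk (ModuleCat.ofHom f) (ModuleCat.ofHom g) 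
    (by ext x; exact hfg.apply_apply_eq_zero x)).ShortExact where
  exact := by
    rw [ShortComplex.moduleCat_exact_iff]
    intro x hx
    exact (hfg x).1 hx
  mono_f := (ModuleCat.mono_iff_injective _).2 hf
  epi_g := (ModuleCat.epi_iff_surjective _).2 hg

/-- connecting map -/
def sDelta : SS m C j →ₗ[R] SS m A (j+1) :=
  Module.DirectLimit.map (fun t => (mkSE hf hg hfg).extClass.postcompOfLinear R _ rfl)
   (by
    intro s t h
    ext x
    exact Abelian.Ext.comp_assoc _ _ _ (zero_add _) rfl (by lia))

include hf hg hfg in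
lemma s_exact2 (y : SS m B j) (hy : sMap m j g y = 0) : ∃ x, sMap m j f x = y := by
  refine dl_exact _ _ _ _ _ _ _ ?_ y hy
  intro t y hy
  exact Abelian.Ext.covariant_sequence_exact₂ _ (mkSE hf hg hfg) y hy

lemma s_exact3 (y : SS m C j) (hy : sDelta m j hf hg hfg y = 0) : ∃ x, sMap m j g x = y := by
  refine dl_exact _ _ _ _ _ _ _ ?_ y hy
  intro t y hy
  exact Abelian.Ext.covariant_sequence_exact₃ _ (mkSE hf hg hfg) y rfl hy

lemma s_exact1 (y : SS m A (j+1)) (hy : sMap m (j+1) f y = 0) : ∃ x, sDelta m j hf hg hfg x = y := by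
  refine dl_exact _ _ _ _ _ _ _ ?_ y hy
  intro t y hy
  exact Abelian.Ext.covariant_sequence_exact₁ _ (mkSE hf hg hfg) y hy rfl

lemma s_zero3 (x) : sDelta m j hf hg hfg (sMap m j g x) = 0 := by
  induction x using ss_ind with | h t x =>
  rw [sMap_of, sDelta, Module.DirectLimit.map_apply_of]
  refine (congrArg (sOf m A (j+1) t) ?_).trans (map_zero _)
  refine (Abelian.Ext.comp_assoc_of_second_deg_zero _ _ _ rfl).trans ?_
  have := (mkSE hf hg hfg).comp_extClass
  refine (congrArg (fun u => x.comp u rfl) this).trans ?_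
  simp

lemma s_zero1 (x) : sMap m (j+1) f (sDelta m j hf hg hfg x) = 0 := by
  induction x using ss_ind with | h t x =>
  rw [sDelta, Module.DirectLimit.map_apply_of, sMap_of]
  refine (congrArg (sOf m B (j+1) t) ?_).trans (map_zero _)
  refine (Abelian.Ext.comp_assoc_of_third_deg_zero _ _ _ rfl).trans ?_
  have := (mkSE hf hg hfg).extClass_comp
  refine (congrArg (fun u => x.comp u rfl) this).trans ?_
  simp

include hf in
lemma s_inj0 : Function.Injective (sMap m 0 f) := by
  rw [injective_iff_map_eq_zero]
  intro y
  induction y using ss_ind with | h t x =>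
  rw [sMap_of]
  intro h
  obtain ⟨u, hu, h⟩ := Module.DirectLimit.of.zero_exact h
  have : preQ m A 0 t u hu x = 0 := by
    have : Mono (ModuleCat.ofHom f) := (ModuleCat.mono_iff_injective _).2 hf
    apply Abelian.Ext.postcomp_mk₀_injective_of_mono (Qt m u) (ModuleCat.ofHom f)
    rw [map_zero, ← h]
    exact Abelian.Ext.comp_assoc_of_third_deg_zero _ _ _ (zero_add _)
  refine (Module.DirectLimit.of_f (i := t) (j := u) (hij := hu) (f := preQ m A 0)).symm.trans ?_
  refine (congrArg (sOf m A 0 u) this).trans (map_zero _)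

/-- consequences -/
def s_iso_shift (h0 : Subsingleton (SS m B j)) (h1 : Subsingleton (SS m B (j+1))) :
    SS m C j ≃ₗ[R] SS m A (j+1) :=
  LinearEquiv.ofBijective (sDelta m j hf hg hfg) ⟨by
    rw [injective_iff_map_eq_zero]
    intro y hy
    obtain ⟨x, rfl⟩ := s_exact3 m j hf hg hfg y hy
    rw [Subsingleton.elim x 0, map_zero], fun y => 
      s_exact1 m j hf hg hfg y (Subsingleton.elim _ _)⟩

def s_iso_g (h0 : Subsingleton (SS m A j)) (h1 : Subsingleton (SS m A (j+1))) :
    SS m B j ≃ₗ[R] SS m C j :=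
  LinearEquiv.ofBijective (sMap m j g) ⟨by
    rw [injective_iff_map_eq_zero]
    intro y hy
    obtain ⟨x, rfl⟩ := s_exact2 m j hf hg hfg y hy
    rw [Subsingleton.elim x 0, map_zero], fun y => 
      s_exact3 m j hf hg hfg y (Subsingleton.elim _ _)⟩

def s_iso_f (h0 : Subsingleton (SS m C j)) (h1 : Subsingleton (SS m C (j+1))) :
    SS m A (j+1) ≃ₗ[R] SS m B (j+1) :=
  LinearEquiv.ofBijective (sMap m (j+1) f) ⟨by
    rw [injective_iff_map_eq_zero]
    intro y hy
    obtain ⟨x, rfl⟩ := s_exact1 m j hf hg hfg y hy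
    rw [Subsingleton.elim x 0, map_zero], fun y => 
      s_exact2 m (j+1) hf hg hfg y (Subsingleton.elim _ _)⟩

def s_iso_f0 (h0 : Subsingleton (SS m C 0)) :
    SS m A 0 ≃ₗ[R] SS m B 0 :=
  LinearEquiv.ofBijective (sMap m 0 f) ⟨s_inj0 m hf, fun y => 
      s_exact2 m 0 hf hg hfg y (Subsingleton.elim _ _)⟩

include hf hg hfg in
lemma s_sub_mid (h0 : Subsingleton (SS m A j)) (h1 : Subsingleton (SS m C j)) :
    Subsingleton (SS m B j) := by
  refine subsingleton_of_forall_eq 0 fun y => ?_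
  obtain ⟨x, rfl⟩ := s_exact2 m j hf hg hfg y (Subsingleton.elim _ _)
  rw [Subsingleton.elim x 0, map_zero]

end

lemma mul_mem_zero {A : Type} [AddCommGroup A] [Module R A] (j t : ℕ) (r : R) (hr : r ∈ m ^ t)
    (x : AE (Qt m t) (ModuleCat.of R A) j) : r • x = 0 := by
  have : x = (Abelian.Ext.mk₀ (𝟙 _)).comp x (zero_add j) := (Abelian.Ext.mk₀_id_comp x).symm
  rw [this, ← Abelian.Ext.smul_comp, ← Abelian.Ext.mk₀_smul]
  have : r • 𝟙 (Qt m t) = 0 := by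
    apply ModuleCat.hom_ext
    apply Submodule.linearMap_qext
    ext
    change Submodule.Quotient.mk (r • (1:R)) = 0
    rw [Submodule.Quotient.mk_eq_zero]
    simpa using hr
  rw [this]; simp

lemma ss_torsion {A : Type} [AddCommGroup A] [Module R A] (j : ℕ) (y : SS m A j) :
    ∃ t : ℕ, ∀ r ∈ m ^ t, r • y = 0 := by
  induction y using ss_ind with | h t x =>
  refine ⟨t, fun r hr => ?_⟩
  rw [← map_smul, mul_mem_zero m j t r hr, map_zero]

lemma ss_zero_of_inj {A : Type} [AddCommGroup A] [Module R A] (j : ℕ) (r : R) (hr : r ∈ m)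
    (h : ∀ y : SS m A j, r • y = 0 → y = 0) : Subsingleton (SS m A j) := by
  refine subsingleton_of_forall_eq 0 fun y => ?_
  obtain ⟨t, ht⟩ := ss_torsion m j y
  have : ∀ s (y : SS m A j), r ^ s • y = 0 → y = 0 := by
    intro s
    induction s with
    | zero => intro y hy; simpa using hy
    | succ s ih => intro y hy; exact h y (ih _ (by rw [smul_smul, ← pow_succ]; exact hy))
  exact this t y (ht _ (Ideal.pow_mem_pow hr t))

lemma ss_zero_of_bij {A : Type} [AddCommGroup A] [Module R A] (j : ℕ) (r : R) (hr : r ∈ m)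
    (h : Function.Bijective (fun a : A => r • a)) : Subsingleton (SS m A j) := by
  apply ss_zero_of_inj m j r hr
  intro y hy
  let e : A ≃ₗ[R] A := LinearEquiv.ofBijective (r • LinearMap.id) h
  have : (sCongr m j e) y = 0 := by
    refine Eq.trans ?_ hy
    exact sMap_smul_id m j r y
  exact (LinearEquiv.map_eq_zero_iff _).1 this

lemma ss_zero_of_module {A : Type} [AddCommGroup A] [Module R A] (j : ℕ) (h : Subsingleton A) :
    Subsingleton (SS m A j) := by
  refine subsingleton_of_forall_eq 0 fun y => ?_
  rw [← sMap_id m j y, Subsingleton.elim (LinearMap.id : A →ₗ[R] A) 0, sMap_zero]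

/-- local cohomology of Mathlib -/
def locEquiv (A : Type) [AddCommGroup A] [Module R A] (j : ℕ) :
    ((localCohomology m j).obj (ModuleCat.of R A)) ≃ₗ[R] SS m A j := by
  let F := localCohomology.diagram (localCohomology.idealPowersDiagram m) j
  haveI : HasColimit F := localCohomology.hasColimitDiagram _ _
  let ev := (evaluation (ModuleCat.{0} R) (ModuleCat.{0} R)).obj (ModuleCat.of R A)
  let hc : IsColimit (ev.mapCocone (colimit.cocone F)) := isColimitOfPreserves ev (colimit.isColimit F)
  let c := ev.mapCocone (colimit.cocone F)
  have hmap : ∀ (s t : ℕ) (h : s ≤ t) (w : Opposite.op (Opposite.op s) ⟶ Opposite.op (Opposite.op t)) 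
      (x : OE (Qt m s) (ModuleCat.of R A) j), 
      cmpE (Qt m t) (ModuleCat.of R A) j (((F ⋙ ev).map w).hom x) = preQ m A j s t h
        (cmpE (Qt m s) (ModuleCat.of R A) j x) := by
    intro s t h w x
    exact cmpE_nat (trQ m h) j x
  let c' : Cocone (F ⋙ ev) := 
    { pt := ModuleCat.of R (SS m A j)
      ι := { app := fun t => ModuleCat.ofHom ((sOf m A j t.unop.unop) ∘ₗ 
                (cmpE (Qt m t.unop.unop) (ModuleCat.of R A) j).toLinearMap)
             naturality := by
               intro s t w
               obtain ⟨⟨s⟩⟩ := s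
               obtain ⟨⟨t⟩⟩ := t
               have h : s ≤ t := w.unop.unop.down.down
               ext x
               have h1 := hmap s t h w x
               refine (congrArg (sOf m A j t) h1).trans ?_
               exact Module.DirectLimit.of_f } }
  let leg : ∀ t : ℕ, AE (Qt m t) (ModuleCat.of R A) j →ₗ[R] c.pt := fun t =>
    LinearMap.comp (M₂ := OE (Qt m t) (ModuleCat.of R A) j) (M₃ := c.pt)
      (c.ι.app (Opposite.op (Opposite.op t))).hom (cmpE (Qt m t) (ModuleCat.of R A) j).symm.toLinearMap
  have hleg : ∀ t x, leg t (cmpE (Qt m t) (ModuleCat.of R A) j x) = 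
      (c.ι.app (Opposite.op (Opposite.op t))).hom x := by
    intro t x
    exact congrArg _ (LinearEquiv.symm_apply_apply _ _)
  have hleg2 : ∀ (s t : ℕ) (h : s ≤ t) (x : AE (Qt m s) (ModuleCat.of R A) j),
      leg t (preQ m A j s t h x) = leg s x := by
    intro s t h x
    obtain ⟨x, rfl⟩ := (cmpE (Qt m s) (ModuleCat.of R A) j).surjective x
    let w : Opposite.op (Opposite.op s) ⟶ Opposite.op (Opposite.op t) := (homOfLE h).op.op
    refine (congrArg (leg t) (hmap s t h w x).symm).trans ?_
    refine (hleg t _).trans (Eq.trans ?_ (hleg s x).symm)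
    exact congrArg (fun u => u.hom x) (c.w w)
  let inv : SS m A j →ₗ[R] c.pt := Module.DirectLimit.lift R ℕ _ _ leg hleg2
  have hinv : ∀ t x, inv (sOf m A j t x) = leg t x := fun t x => Module.DirectLimit.lift_of _ _ _
  have hdesc : ∀ t (x : OE (Qt m t) (ModuleCat.of R A) j), (hc.desc c').hom 
      ((c.ι.app (Opposite.op (Opposite.op t))).hom x) = 
      sOf m A j t (cmpE (Qt m t) (ModuleCat.of R A) j x) := fun t x =>
    congrArg (fun u => u.hom x) (hc.fac c' (Opposite.op (Opposite.op t)))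
  refine LinearEquiv.ofLinearMap (M := c.pt) (hc.desc c').hom inv ?_ ?_
  · refine LinearMap.ext fun y => ?_
    induction y using ss_ind with | h t x =>
    obtain ⟨x, rfl⟩ := (cmpE (Qt m t) (ModuleCat.of R A) j).surjective x
    refine (congrArg (hc.desc c').hom ((hinv t _).trans (hleg t x))).trans (hdesc t x)
  · have : hc.desc c' ≫ ModuleCat.ofHom inv = 𝟙 c.pt := by
      apply hc.hom_ext
      rintro ⟨⟨t⟩⟩
      apply ModuleCat.hom_ext
      refine LinearMap.ext fun x => ?_
      exact (congrArg inv (hdesc t x)).trans ((hinv t _).trans (hleg t x))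
    exact congrArg (fun u => u.hom) this

end St15
end


noncomputable section
namespace St15
open Limits
set_option linter.unusedVariables false
set_option linter.unusedSectionVars false
set_option linter.unusedSimpArgs false

variable {R : Type} [CommRing R] (m : Ideal R)

section
variable (N : Type) [AddCommGroup N] [Module R N]

def ev0 (t : ℕ) : AE (Qt m t) (ModuleCat.of R N) 0 →ₗ[R] N where
  toFun x := (Abelian.Ext.linearEquiv₀ (R := R) x).hom (Submodule.Quotient.mk 1)
  map_add' x y := by simp
  map_smul' r x := by simp

lemma ev0_mk (t : ℕ) (f : Qt m t ⟶ ModuleCat.of R N) :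
    ev0 m N t (Abelian.Ext.mk₀ f) = f.hom (Submodule.Quotient.mk 1) := by
  have : Abelian.Ext.linearEquiv₀ (R := R) (Abelian.Ext.mk₀ f) = f := by
    rw [← LinearEquiv.eq_symm_apply]; rfl
  change (Abelian.Ext.linearEquiv₀ (R := R) (Abelian.Ext.mk₀ f)).hom _ = _
  rw [this]

lemma mk0_surj {X Y : ModuleCat.{0} R} (x : AE X Y 0) : ∃ f : X ⟶ Y, Abelian.Ext.mk₀ f = x :=
  ⟨Abelian.Ext.linearEquiv₀ (R := R) x, by simp⟩

lemma ev0_inj (t : ℕ) : Function.Injective (ev0 m N t) := by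
  rw [injective_iff_map_eq_zero]
  intro x hx
  obtain ⟨f, rfl⟩ := mk0_surj x
  rw [ev0_mk] at hx
  have : f = 0 := by
    apply ModuleCat.hom_ext
    apply Submodule.linearMap_qext
    ext
    exact hx
  rw [this, Abelian.Ext.mk₀_zero]

def evS : SS m N 0 →ₗ[R] N := Module.DirectLimit.lift R ℕ _ _ (ev0 m N) (by
  intro s t h x
  obtain ⟨f, rfl⟩ := mk0_surj x
  rw [preQ_apply, Abelian.Ext.mk₀_comp_mk₀, ev0_mk, ev0_mk]
  rfl)

lemma evS_of (t x) : evS m N (sOf m N 0 t x) = ev0 m N t x := Module.DirectLimit.lift_of _ _ _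

lemma evS_inj : Function.Injective (evS m N) := 
  Module.DirectLimit.lift_injective _ _ (ev0_inj m N)

/-- power torsion -/
def IsTor : Prop := ∀ x : N, ∃ t : ℕ, ∀ r ∈ m ^ t, r • x = 0

variable {N}
lemma evS_hits (x : N) (t : ℕ) (h : ∀ r ∈ m ^ t, r • x = 0) : ∃ y, evS m N y = x := by
  let f : Qt m t ⟶ ModuleCat.of R N := ModuleCat.ofHom
    (Submodule.liftQ _ (LinearMap.toSpanSingleton R N x) (by
      intro r hr; simpa using h r hr))
  refine ⟨sOf m N 0 t (Abelian.Ext.mk₀ f), ?_⟩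
  rw [evS_of, ev0_mk]
  change (1:R) • x = x
  simp

lemma evS_surj (h : IsTor m N) : Function.Surjective (evS m N) := by
  intro x
  obtain ⟨t, ht⟩ := h x
  exact evS_hits m x t ht

def evE (h : IsTor m N) : SS m N 0 ≃ₗ[R] N :=
  LinearEquiv.ofBijective (evS m N) ⟨evS_inj m N, evS_surj m h⟩

variable {N' : Type} [AddCommGroup N'] [Module R N']
lemma evS_nat (f : N →ₗ[R] N') (y) : evS m N' (sMap m 0 f y) = f (evS m N y) := by
  induction y using ss_ind with | h t x =>
  obtain ⟨g, rfl⟩ := mk0_surj x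
  rw [sMap_of, evS_of, evS_of, Abelian.Ext.mk₀_comp_mk₀, ev0_mk, ev0_mk]
  rfl

lemma ss_inj_zero (E : Type) [AddCommGroup E] [Module R E] [Module.Injective R E] (j : ℕ) :
    Subsingleton (SS m E (j+1)) := by
  have : Injective (ModuleCat.of R E) := Module.injective_object_of_injective_module R E
  refine subsingleton_of_forall_eq 0 fun y => ?_
  induction y using ss_ind with | h t x =>
  rw [Abelian.Ext.eq_zero_of_injective x, map_zero]

lemma IsTor.of_inj (h : IsTor m N') (f : N →ₗ[R] N') (hf : Function.Injective f) : IsTor m N := by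
  intro x
  obtain ⟨t, ht⟩ := h (f x)
  exact ⟨t, fun r hr => hf (by rw [map_smul, ht r hr, map_zero])⟩

lemma IsTor.of_surj (h : IsTor m N) (f : N →ₗ[R] N') (hf : Function.Surjective f) : IsTor m N' := by
  intro x
  obtain ⟨x, rfl⟩ := hf x
  obtain ⟨t, ht⟩ := h x
  exact ⟨t, fun r hr => by rw [← map_smul, ht r hr, map_zero]⟩

variable (N)
/-- the torsion submodule -/
def Gam : Submodule R N where
  carrier := {x | ∃ t : ℕ, ∀ r ∈ m ^ t, r • x = 0}
  add_mem' := by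
    rintro a b ⟨s, hs⟩ ⟨t, ht⟩
    refine ⟨max s t, fun r hr => ?_⟩
    rw [smul_add, hs r (Ideal.pow_le_pow_right (le_max_left _ _) hr), 
      ht r (Ideal.pow_le_pow_right (le_max_right _ _) hr), add_zero]
  zero_mem' := ⟨0, by simp⟩
  smul_mem' := by
    rintro c x ⟨t, ht⟩
    exact ⟨t, fun r hr => by rw [smul_comm, ht r hr, smul_zero]⟩

lemma gam_tor : IsTor m (Gam m N) := fun x => by
  obtain ⟨t, ht⟩ := x.2
  exact ⟨t, fun r hr => Subtype.ext (ht r hr)⟩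

variable {N} in
/-- uniform exponent -/
lemma tor_unif [Module.Finite R N] (h : IsTor m N) : ∃ t : ℕ, ∀ r ∈ m ^ t, ∀ x : N, r • x = 0 := by
  obtain ⟨s, hs⟩ := Module.Finite.fg_top (R := R) (M := N)
  choose t ht using h
  refine ⟨s.sup t, fun r hr x => ?_⟩
  have hx : x ∈ Submodule.span R (s : Set N) := hs ▸ Submodule.mem_top
  induction hx using Submodule.span_induction with
  | mem x hx => exact ht x r (Ideal.pow_le_pow_right (Finset.le_sup hx) hr)
  | zero => simp
  | add x y _ _ hx hy => rw [smul_add, hx, hy, add_zero]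
  | smul c x _ hx => rw [smul_comm, hx, smul_zero]

lemma gam_injective [IsNoetherianRing R] (E : Type) [AddCommGroup E] [Module R E] [Module.Injective R E] :
    Module.Injective R (Gam m E) := by
  apply Module.Baer.injective
  intro I g
  obtain ⟨t, ht⟩ := tor_unif (N := LinearMap.range g) m
    ((gam_tor m E).of_inj m (LinearMap.range g).subtype (Subtype.val_injective))
  have hg : ∀ r ∈ m ^ t, ∀ x : I, r • g x = 0 := fun r hr x => 
    congrArg Subtype.val (ht r hr ⟨g x, x, rfl⟩)
  obtain ⟨c, hc⟩ := Ideal.exists_pow_inf_eq_pow_smul (M := R) m I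
  have hk : ∀ x : I, (x : R) ∈ m ^ (t + c) → g x = 0 := by
    rintro ⟨x, hxI⟩ hx
    have h1 : x ∈ m ^ t • (m ^ c • (⊤ : Submodule R R) ⊓ I) := by
      have := hc (t + c) (by omega)
      rw [Nat.add_sub_cancel] at this
      rw [← this]
      refine ⟨?_, hxI⟩
      simpa using hx
    have h2 : x ∈ m ^ t • (I : Submodule R R) := Submodule.smul_mono le_rfl inf_le_right h1
    have h3 : ∃ hx : x ∈ I, g ⟨x, hx⟩ = 0 := by
      refine Submodule.smul_induction_on h2 ?_ ?_
      · intro r hr y hy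
        exact ⟨I.mul_mem_left _ hy, by
          have := hg r hr ⟨y, hy⟩
          rw [← map_smul] at this
          exact this⟩
      · rintro x y ⟨hx, hx'⟩ ⟨hy, hy'⟩
        refine ⟨I.add_mem hx hy, ?_⟩
        have : (⟨x + y, I.add_mem hx hy⟩ : I) = ⟨x, hx⟩ + ⟨y, hy⟩ := rfl
        rw [this, map_add, hx', hy', add_zero]
    exact h3.2
  let J : Submodule R I := Submodule.comap I.subtype (m ^ (t + c))
  let f : (I ⧸ J) →ₗ[R] (R ⧸ m ^ (t + c)) := Submodule.mapQ J (m ^ (t+c)) I.subtype le_rfl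
  have hf : Function.Injective f := by
    rw [injective_iff_map_eq_zero]
    intro x
    obtain ⟨x, rfl⟩ := Submodule.Quotient.mk_surjective _ x
    intro h
    rw [Submodule.Quotient.mk_eq_zero]
    exact (Submodule.Quotient.mk_eq_zero (m ^ (t + c))).1 h
  let gb : (I ⧸ J) →ₗ[R] E := Submodule.liftQ J ((Gam m E).subtype ∘ₗ g) (by
    intro x hx
    rw [LinearMap.mem_ker, LinearMap.comp_apply, hk x hx, map_zero])
  obtain ⟨h, hh⟩ := Module.Injective.out f hf gb
  have h1 : h (Submodule.Quotient.mk 1) ∈ Gam m E := by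
    refine ⟨t + c, fun r hr => ?_⟩
    rw [← map_smul]
    have : r • (Submodule.Quotient.mk 1 : R ⧸ m ^ (t+c)) = 0 := by
      rw [← Submodule.Quotient.mk_smul, Submodule.Quotient.mk_eq_zero]; simpa using hr
    rw [this, map_zero]
  refine ⟨LinearMap.toSpanSingleton R _ ⟨_, h1⟩, fun x hx => ?_⟩
  apply Subtype.ext
  have h2 := hh (Submodule.Quotient.mk ⟨x, hx⟩)
  refine Eq.trans ?_ h2
  change x • h (Submodule.Quotient.mk 1) = _
  rw [← map_smul, ← Submodule.Quotient.mk_smul]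
  simp only [smul_eq_mul, mul_one]
  rfl

/-- Lemma D -/
lemma ss_tor_zero [IsNoetherianRing R] (j : ℕ) : ∀ (N : Type) [AddCommGroup N] [Module R N],
    IsTor m N → Subsingleton (SS m N (j+1)) := by
  induction j with
  | zero =>
    intro N _ _ hN
    let E := Injective.under (ModuleCat.of R N)
    have : Injective (ModuleCat.of R E) := inferInstanceAs (Injective E)
    have : Module.Injective R E := Module.injective_module_of_injective_object R E
    have := gam_injective m E
    let i0 : N →ₗ[R] E := (Injective.ι (ModuleCat.of R N)).hom
    have hi0 : Function.Injective i0 := (ModuleCat.mono_iff_injective (Injective.ι (ModuleCat.of R N))).1 inferInstance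
    let i : N →ₗ[R] Gam m E := i0.codRestrict (Gam m E) (fun x => by
      obtain ⟨t, ht⟩ := hN x
      exact ⟨t, fun r hr => by rw [← map_smul, ht r hr, map_zero]⟩)
    have hi : Function.Injective i := fun x y h => hi0 (congrArg Subtype.val h)
    let g : Gam m E →ₗ[R] (Gam m E ⧸ LinearMap.range i) := Submodule.mkQ _
    have hg : Function.Surjective g := Submodule.mkQ_surjective _
    have hig : Function.Exact i g := LinearMap.exact_map_mkQ_range i
    refine subsingleton_of_forall_eq 0 fun y => ?_
    obtain ⟨x, rfl⟩ := s_exact1 m 0 hi hg hig y ((ss_inj_zero m (Gam m E) 0).elim _ _)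
    have : ∃ x', sMap m 0 g x' = x := by
      obtain ⟨b, hb⟩ := hg (evS m _ x)
      obtain ⟨y', hy'⟩ := evS_surj m (gam_tor m E) b
      refine ⟨y', evS_inj m _ ?_⟩
      rw [evS_nat, hy', hb]
    obtain ⟨x', rfl⟩ := this
    exact s_zero3 m 0 hi hg hig x'
  | succ j ih =>
    intro N _ _ hN
    let E := Injective.under (ModuleCat.of R N)
    have : Injective (ModuleCat.of R E) := inferInstanceAs (Injective E)
    have : Module.Injective R E := Module.injective_module_of_injective_object R E
    have := gam_injective m E
    let i0 : N →ₗ[R] E := (Injective.ι (ModuleCat.of R N)).hom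
    have hi0 : Function.Injective i0 := (ModuleCat.mono_iff_injective (Injective.ι (ModuleCat.of R N))).1 inferInstance
    let i : N →ₗ[R] Gam m E := i0.codRestrict (Gam m E) (fun x => by
      obtain ⟨t, ht⟩ := hN x
      exact ⟨t, fun r hr => by rw [← map_smul, ht r hr, map_zero]⟩)
    have hi : Function.Injective i := fun x y h => hi0 (congrArg Subtype.val h)
    let g : Gam m E →ₗ[R] (Gam m E ⧸ LinearMap.range i) := Submodule.mkQ _
    have hg : Function.Surjective g := Submodule.mkQ_surjective _
    have hig : Function.Exact i g := LinearMap.exact_map_mkQ_range i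
    have h1 := ih (Gam m E ⧸ LinearMap.range i) ((gam_tor m E).of_surj m g hg)
    exact (s_iso_shift m (j+1) hi hg hig (ss_inj_zero m _ _) (ss_inj_zero m _ _)).symm.toEquiv.subsingleton
end

end St15
end


noncomputable section
namespace St15
open Limits
open scoped Pointwise
set_option linter.unusedVariables false
set_option linter.unusedSectionVars false
set_option linter.unusedSimpArgs false

section
variable {R : Type} [CommRing R] (m : Ideal R)
variable {N : Type} [AddCommGroup N] [Module R N]

lemma quot_exact (x : R) : Function.Exact (x • LinearMap.id : N →ₗ[R] N)
    (Submodule.mkQ (x • ⊤ : Submodule R N)) := by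
  intro y
  constructor
  · intro h
    rw [Submodule.mkQ_apply, Submodule.Quotient.mk_eq_zero] at h
    obtain ⟨z, -, rfl⟩ := (Submodule.mem_smul_pointwise_iff_exists _ _ _).1 h
    exact ⟨z, rfl⟩
  · rintro ⟨z, rfl⟩
    rw [Submodule.mkQ_apply, Submodule.Quotient.mk_eq_zero]
    exact Submodule.smul_mem_pointwise_smul _ _ _ Submodule.mem_top

lemma reg_inj {x : R} (hx : IsSMulRegular N x) :
    Function.Injective (x • LinearMap.id : N →ₗ[R] N) := hx

lemma ss_reg_zero {x : R} (hxm : x ∈ m) (hx : IsSMulRegular N x) : Subsingleton (SS m N 0) := by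
  apply ss_zero_of_inj m 0 x hxm
  intro y hy
  rw [← sMap_smul_id] at hy
  exact s_inj0 m (reg_inj hx) (hy.trans (map_zero _).symm)

lemma ss_reg_succ {x : R} (hxm : x ∈ m) (hx : IsSMulRegular N x) (j : ℕ)
    (h : Subsingleton (SS m (QuotSMulTop x N) j)) : Subsingleton (SS m N (j+1)) := by
  apply ss_zero_of_inj m (j+1) x hxm
  intro y hy
  rw [← sMap_smul_id] at hy
  obtain ⟨z, rfl⟩ := s_exact1 m j (reg_inj hx) (Submodule.mkQ_surjective _) (quot_exact x) y hy
  have : z = 0 := Subsingleton.elim _ _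
  rw [this, map_zero]

lemma exact_sub (P : Submodule R N) : Function.Exact P.subtype P.mkQ := by
  intro y
  simp

/-- Grothendieck vanishing. -/
theorem ss_dim_zero [IsNoetherianRing R] (j : ℕ) : ∀ (N : Type) [AddCommGroup N] [Module R N]
    [Module.Finite R N], mDim R N < (j : WithBot ℕ∞) → Subsingleton (SS m N j) := by
  induction j with
  | zero =>
    intro N _ _ _ h
    apply ss_zero_of_module
    rw [← Module.supportDim_eq_bot_iff_subsingleton (R := R)]
    change Module.supportDim R N < ((0:ℕ) : WithBot ℕ∞) at h
    by_contra hb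
    obtain ⟨a, ha⟩ := WithBot.ne_bot_iff_exists.1 hb
    rw [← ha] at h
    have : a < 0 := by exact_mod_cast h
    simp at this
  | succ j ih =>
    intro N _ _ _ h
    refine s_sub_mid m (j+1) (Gam m N).subtype_injective (Gam m N).mkQ_surjective
      (exact_sub _) (ss_tor_zero m j _ (gam_tor m N)) ?_
    have hh : Subsingleton ((R ⧸ m) →ₗ[R] (N ⧸ Gam m N)) := by
      refine subsingleton_of_forall_eq 0 fun f => ?_
      apply Submodule.linearMap_qext
      ext
      change f (Submodule.Quotient.mk 1) = 0
      obtain ⟨y, hy⟩ := (Gam m N).mkQ_surjective (f (Submodule.Quotient.mk 1))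
      rw [← hy, Submodule.mkQ_apply, Submodule.Quotient.mk_eq_zero]
      have h1 : ∀ r ∈ m, r • y ∈ Gam m N := by
        intro r hr
        rw [← Submodule.Quotient.mk_eq_zero, Submodule.Quotient.mk_smul]
        rw [← Submodule.mkQ_apply, hy, ← map_smul]
        have : r • (Submodule.Quotient.mk 1 : R ⧸ m) = 0 := by
          rw [← Submodule.Quotient.mk_smul, Submodule.Quotient.mk_eq_zero]
          simpa using hr
        rw [this, map_zero]
      obtain ⟨t, ht⟩ := tor_unif m (gam_tor m N)
      refine ⟨t + 1, fun r hr => ?_⟩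
      rw [pow_succ] at hr
      refine Submodule.mul_induction_on hr ?_ ?_
      · intro a ha b hb
        rw [mul_smul]
        exact congrArg Subtype.val (ht a ha ⟨b • y, h1 b hb⟩)
      · intro a b ha hb
        rw [add_smul, ha, hb, add_zero]
    obtain ⟨x, hxm, hx⟩ := IsSMulRegular.subsingleton_linearMap_iff.1 hh
    rw [Ideal.annihilator_quotient] at hxm
    apply ss_reg_succ m hxm hx
    apply ih
    have h1 : Module.supportDim R (QuotSMulTop x (N ⧸ Gam m N)) + 1 ≤ Module.supportDim R (N ⧸ Gam m N) := 
      Module.supportDim_quotSMulTop_succ_le_of_notMem_minimalPrimes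
        (fun p hp => hx.notMem_of_mem_minimalPrimes hp)
    have h2 : Module.supportDim R (N ⧸ Gam m N) ≤ Module.supportDim R N := 
      Module.supportDim_le_of_surjective _ (Gam m N).mkQ_surjective
    have h3 := (h1.trans h2).trans_lt h
    change Module.supportDim R _ < _
    rw [Nat.cast_succ] at h3
    exact lt_of_add_lt_add_right h3
end

section
variable {R : Type} [CommRing R] (m : Ideal R)

def Dep (q : ℕ) (Q : Type) [AddCommGroup Q] [Module R Q] : Prop :=
  ∀ j < q, Subsingleton (AE (ModuleCat.of R (R ⧸ m)) (ModuleCat.of R Q) j)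

lemma dep_of_depth (q : ℕ) (Q : Type) [AddCommGroup Q] [Module R Q]
    (h : (q : ℕ∞) ≤ mDepth R m Q) : Dep m q Q := by
  intro j hj
  by_contra hc
  rw [not_subsingleton_iff_nontrivial] at hc
  have h1 : mDepth R m Q ≤ j := by
    apply sInf_le
    exact ⟨j, rfl, (cmpE (ModuleCat.of R (R ⧸ m)) (ModuleCat.of R Q) j).toEquiv.nontrivial⟩
  have := h.trans h1
  norm_cast at this
  omega

lemma Dep.quot {q : ℕ} {Q : Type} [AddCommGroup Q] [Module R Q] (h : Dep m (q+1) Q)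
    {x : R} (hx : IsSMulRegular Q x) : Dep m q (QuotSMulTop x Q) := by
  intro j hj
  have h0 := h j (by omega)
  have h1 := h (j+1) (by omega)
  have se := mkSE (reg_inj hx) (Submodule.mkQ_surjective _) (quot_exact x)
  refine subsingleton_of_forall_eq 0 fun y => ?_
  obtain ⟨z, rfl⟩ := Abelian.Ext.covariant_sequence_exact₃ _ se y rfl (Subsingleton.elim (α := AE _ _ _) _ _)
  have : z = 0 := Subsingleton.elim (α := AE _ _ _) _ _
  rw [this, Abelian.Ext.zero_comp]

lemma Dep.hom {q : ℕ} {Q : Type} [AddCommGroup Q] [Module R Q] (h : Dep m (q+1) Q) :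
    Subsingleton ((R ⧸ m) →ₗ[R] Q) := by
  have h0 := h 0 (by omega)
  refine subsingleton_of_forall_eq 0 fun f => ?_
  have h1 : Abelian.Ext.mk₀ (ModuleCat.ofHom f) = (0 : AE _ _ 0) := Subsingleton.elim (α := AE _ _ _) _ _
  rw [Abelian.Ext.mk₀_eq_zero_iff] at h1
  exact congrArg ModuleCat.Hom.hom h1
end

section
variable {k : Type} [Field k] {n : ℕ}

lemma linForm_mem (a : Fin n → k) : linForm k n a ∈ irrIdeal k n :=
  Ideal.sum_mem _ fun i _ => Ideal.mul_mem_left _ _ (Ideal.subset_span ⟨i, rfl⟩)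

def linFormL : (Fin n → k) →ₗ[k] MvPolynomial (Fin n) k where
  toFun := linForm k n
  map_add' a b := by simp [linForm, add_mul, Finset.sum_add_distrib]
  map_smul' c a := by simp [linForm, MvPolynomial.smul_eq_C_mul, mul_assoc, Finset.mul_sum]

lemma exists_linForm [Infinite k] {q : ℕ} {Q : Type} [AddCommGroup Q] [Module (MvPolynomial (Fin n) k) Q]
    [Module.Finite (MvPolynomial (Fin n) k) Q] (h : Dep (irrIdeal k n) (q+1) Q) :
    ∃ a : Fin n → k, IsSMulRegular Q (linForm k n a) := by
  classical
  obtain ⟨r, hrm, hr⟩ := IsSMulRegular.subsingleton_linearMap_iff.1 h.hom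
  rw [Ideal.annihilator_quotient] at hrm
  have hfin := associatedPrimes.finite (MvPolynomial (Fin n) k) Q
  let s : Finset (Submodule k (Fin n → k)) := hfin.toFinset.image
    (fun p => (p.restrictScalars k).comap linFormL)
  have hs : ⊤ ∉ s := by
    intro ht
    obtain ⟨p, hp, hpt⟩ := Finset.mem_image.1 ht
    rw [Set.Finite.mem_toFinset] at hp
    have hm : irrIdeal k n ≤ p := by
      rw [irrIdeal, Ideal.span_le]
      rintro _ ⟨i, rfl⟩
      have : Pi.single i 1 ∈ (⊤ : Submodule k (Fin n → k)) := trivial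
      rw [← hpt] at this
      have h2 : linForm k n (Pi.single i 1) ∈ p := this
      simpa [linForm, Pi.single_apply, apply_ite] using h2
    have h3 : r ∈ ⋃ p ∈ associatedPrimes (MvPolynomial (Fin n) k) Q, (p : Set _) := 
      Set.mem_biUnion hp (hm hrm)
    rw [biUnion_associatedPrimes_eq_compl_regular] at h3
    exact h3 hr
  have h1 := Subspace.biUnion_ne_univ_of_top_notMem hs
  rw [Set.ne_univ_iff_exists_notMem] at h1
  obtain ⟨a, ha⟩ := h1
  refine ⟨a, ?_⟩
  by_contra hc
  have h3 : linForm k n a ∈ ⋃ p ∈ associatedPrimes (MvPolynomial (Fin n) k) Q, (p : Set _) := by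
    rw [biUnion_associatedPrimes_eq_compl_regular]
    exact hc
  rw [Set.mem_iUnion₂] at h3
  obtain ⟨p, hp, h4⟩ := h3
  apply ha
  rw [Set.mem_iUnion₂]
  exact ⟨_, Finset.mem_image.2 ⟨p, hfin.mem_toFinset.2 hp, rfl⟩, h4⟩

lemma ss_dep_zero [Infinite k] (q : ℕ) : ∀ (Q : Type) [AddCommGroup Q] [Module (MvPolynomial (Fin n) k) Q]
    [Module.Finite (MvPolynomial (Fin n) k) Q] (h : Dep (irrIdeal k n) q Q) (j : ℕ) (hj : j < q),
    Subsingleton (SS (irrIdeal k n) Q j) := by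
  induction q with
  | zero => intro Q _ _ _ _ j hj; omega
  | succ q ih =>
    intro Q _ _ _ h j hj
    obtain ⟨a, ha⟩ := exists_linForm h
    cases j with
    | zero => exact ss_reg_zero _ (linForm_mem a) ha
    | succ j => exact ss_reg_succ _ (linForm_mem a) ha j (ih _ (h.quot _ ha) j (by omega))
end

end St15
end


noncomputable section
namespace St15
open Limits
open scoped Pointwise
set_option linter.unusedVariables false
set_option linter.unusedSectionVars false
set_option linter.unusedSimpArgs false

section
variable {R : Type} [CommRing R]
variable {A B C : Type} [AddCommGroup A] [Module R A] [AddCommGroup B] [Module R B]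
  [AddCommGroup C] [Module R C]

lemma mDim_inj (f : A →ₗ[R] B) (hf : Function.Injective f) : mDim R A ≤ mDim R B :=
  Module.supportDim_le_of_injective f hf

lemma mDim_surj (f : A →ₗ[R] B) (hf : Function.Surjective f) : mDim R B ≤ mDim R A :=
  Module.supportDim_le_of_surjective f hf

lemma mDim_exact {f : A →ₗ[R] B} {g : B →ₗ[R] C} (hf : Function.Injective f) (hg : Function.Surjective g)
  (hfg : Function.Exact f g) (c : WithBot ℕ∞) (hA : mDim R A ≤ c) (hC : mDim R C ≤ c) : mDim R B ≤ c := by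
  have hs := Module.support_of_exact hfg hf hg
  refine iSup_le fun p => ?_
  have hup : ∀ i, (p.head).1 ≤ (p i).1 := fun i => LTSeries.head_le p i
  have hp : (p.head).1 ∈ Module.support R A ∪ Module.support R C := hs ▸ p.head.2
  rcases hp with hp | hp
  · let p' : LTSeries (Module.support R A) := ⟨p.length, fun i => ⟨(p i).1, 
      Module.mem_support_mono (hup i) hp⟩, fun i => p.step i⟩
    exact le_trans (Order.LTSeries.length_le_krullDim p') hA
  · let p' : LTSeries (Module.support R C) := ⟨p.length, fun i => ⟨(p i).1, 
      Module.mem_support_mono (hup i) hp⟩, fun i => p.step i⟩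
    exact le_trans (Order.LTSeries.length_le_krullDim p') hC

lemma mDim_sup (P P' : Submodule R A) (c : WithBot ℕ∞) (h : mDim R P ≤ c) (h' : mDim R P' ≤ c) :
    mDim R ↥(P ⊔ P') ≤ c := by
  have h1 : mDim R (P × P') ≤ c := 
    mDim_exact (f := LinearMap.inl R P P') (g := LinearMap.snd R P P') 
      LinearMap.inl_injective LinearMap.snd_surjective (by
        intro x
        constructor
        · intro h; exact ⟨x.1, Prod.ext rfl h.symm⟩
        · rintro ⟨y, rfl⟩; rfl) c h h'
  refine le_trans (mDim_surj (LinearMap.coprod (Submodule.inclusion le_sup_left) 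
    (Submodule.inclusion le_sup_right) : P × P' →ₗ[R] ↥(P ⊔ P')) ?_) h1
  rintro ⟨x, hx⟩
  obtain ⟨y, hy, z, hz, rfl⟩ := Submodule.mem_sup.1 hx
  exact ⟨⟨⟨y, hy⟩, ⟨z, hz⟩⟩, rfl⟩

def subQuotBot (P : Submodule R A) : P ≃ₗ[R] subQuot R ⊥ P :=
  (Submodule.quotEquivOfEqBot _ (by ext; simp)).symm

lemma mDim_subQuotBot (P : Submodule R A) : mDim R (subQuot R ⊥ P) = mDim R P := 
  le_antisymm (mDim_surj _ (subQuotBot P).surjective) (mDim_inj _ (subQuotBot P).injective)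
  
lemma wb_lt (x : WithBot ℕ∞) (c : ℕ) (h : x < ((c+1 : ℕ) : WithBot ℕ∞)) : x ≤ (c : WithBot ℕ∞) := by
  induction x with
  | bot => exact bot_le
  | coe x => 
    have h1 : x < ((c+1 : ℕ) : ℕ∞) := by exact_mod_cast h
    have h2 : x ≤ (c : ℕ∞) := by
      rw [Nat.cast_succ] at h1
      exact Order.le_of_lt_add_one h1
    exact_mod_cast h2

lemma mDim_bot (h : mDim R A < ((0:ℕ) : WithBot ℕ∞)) : Subsingleton A := by
  rw [← Module.supportDim_eq_bot_iff_subsingleton (R := R)]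
  change Module.supportDim R A < ((0:ℕ) : WithBot ℕ∞) at h
  by_contra hb
  obtain ⟨a, ha⟩ := WithBot.ne_bot_iff_exists.1 hb
  rw [← ha] at h
  have : a < 0 := by exact_mod_cast h
  simp at this
end

section
variable (k : Type) [Field k] (n : ℕ)
    (M : Type) [AddCommGroup M] [Module (MvPolynomial (Fin n) k) M] [Module k M]
    [IsScalarTower k (MvPolynomial (Fin n) k) M] 
    (𝒜 : ℤ → Submodule k M)

lemma gr_bot : IsGradedSub k n M 𝒜 ⊥ := by
  intro x hx
  have : x = 0 := by simpa using hx
  rw [this]; exact zero_mem _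

lemma gr_top (hInt : DirectSum.IsInternal 𝒜) : IsGradedSub k n M 𝒜 ⊤ := by
  intro x hx
  have h := hInt.submodule_iSup_eq_top
  have h2 : x ∈ ⨆ e, 𝒜 e := h ▸ Submodule.mem_top
  refine (iSup_mono fun e => ?_ : ⨆ e, 𝒜 e ≤ _) h2
  intro y hy
  exact ⟨trivial, hy⟩

lemma mem_of_le' {P Q : Submodule k M} (h : P ≤ Q) {x : M} (hx : x ∈ P) : x ∈ Q := h hx

lemma gr_sup {P P' : Submodule (MvPolynomial (Fin n) k) M} (h : IsGradedSub k n M 𝒜 P)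
    (h' : IsGradedSub k n M 𝒜 P') : IsGradedSub k n M 𝒜 (P ⊔ P') := by
  intro x hx
  obtain ⟨y, hy, z, hz, rfl⟩ := Submodule.mem_sup.1 (hx : x ∈ P ⊔ P')
  refine add_mem (mem_of_le' k M (iSup_mono fun e => ?_) (h hy)) (mem_of_le' k M (iSup_mono fun e => ?_) (h' hz))
  · exact inf_le_inf_right _ (fun w hw => (le_sup_left : P ≤ P ⊔ P') hw)
  · exact inf_le_inf_right _ (fun w hw => (le_sup_right : P' ≤ P ⊔ P') hw)

abbrev dl (c : ℕ) := deltaPairG k n M 𝒜 ⊥ c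
abbrev dlp (c : ℕ) := deltaPairGPred k n M 𝒜 ⊥ c
abbrev Qd (c : ℕ) := subQuot (MvPolynomial (Fin n) k) (dlp k n M 𝒜 c) (dl k n M 𝒜 c)

variable [Module.Finite (MvPolynomial (Fin n) k) M]

lemma dl_mem (c : ℕ) : IsGradedSub k n M 𝒜 (dl k n M 𝒜 c) ∧ 
    mDim (MvPolynomial (Fin n) k) (dl k n M 𝒜 c) ≤ (c : WithBot ℕ∞) := by
  have h := CompleteLattice.WellFoundedGT.isSupClosedCompact (Submodule (MvPolynomial (Fin n) k) M)
    inferInstance {P | ⊥ ≤ P ∧ IsGradedSub k n M 𝒜 P ∧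
    mDim (MvPolynomial (Fin n) k) (subQuot (MvPolynomial (Fin n) k) ⊥ P) ≤ (c : WithBot ℕ∞)} 
    ⟨⊥, le_rfl, gr_bot k n M 𝒜, by 
      rw [mDim_subQuotBot]
      have : mDim (MvPolynomial (Fin n) k) (⊥ : Submodule (MvPolynomial (Fin n) k) M) = ⊥ :=
        Module.supportDim_eq_bot_of_subsingleton _ _
      rw [this]; exact bot_le⟩ (by
      rintro P ⟨-, h1, h2⟩ P' ⟨-, h1', h2'⟩
      refine ⟨bot_le, gr_sup k n M 𝒜 h1 h1', ?_⟩
      rw [mDim_subQuotBot] at *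
      exact mDim_sup _ _ _ h2 h2')
  obtain ⟨-, h1, h2⟩ := h
  rw [mDim_subQuotBot] at h2
  exact ⟨h1, h2⟩

omit [Module.Finite (MvPolynomial (Fin n) k) M] in
lemma le_dl (c : ℕ) (P : Submodule (MvPolynomial (Fin n) k) M) (h : IsGradedSub k n M 𝒜 P)
    (h' : mDim (MvPolynomial (Fin n) k) P ≤ (c : WithBot ℕ∞)) : P ≤ dl k n M 𝒜 c := 
  le_sSup ⟨bot_le, h, by rwa [mDim_subQuotBot]⟩

lemma dlp_mem (c : ℕ) : IsGradedSub k n M 𝒜 (dlp k n M 𝒜 c) ∧ 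
    mDim (MvPolynomial (Fin n) k) (dlp k n M 𝒜 c) < (c : WithBot ℕ∞) := by
  cases c with
  | zero => 
    refine ⟨gr_bot k n M 𝒜, ?_⟩
    have : mDim (MvPolynomial (Fin n) k) (⊥ : Submodule (MvPolynomial (Fin n) k) M) = ⊥ :=
        Module.supportDim_eq_bot_of_subsingleton _ _
    change mDim (MvPolynomial (Fin n) k) (⊥ : Submodule (MvPolynomial (Fin n) k) M) < _
    rw [this]
    exact WithBot.bot_lt_coe _
  | succ c =>
    refine ⟨(dl_mem k n M 𝒜 c).1, (dl_mem k n M 𝒜 c).2.trans_lt ?_⟩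
    exact_mod_cast Nat.lt_succ_self c

lemma dlp_le (c : ℕ) : dlp k n M 𝒜 c ≤ dl k n M 𝒜 c := 
  le_dl k n M 𝒜 c _ (dlp_mem k n M 𝒜 c).1 (dlp_mem k n M 𝒜 c).2.le

lemma le_dlp (c : ℕ) (P : Submodule (MvPolynomial (Fin n) k) M) (h : IsGradedSub k n M 𝒜 P)
    (h' : mDim (MvPolynomial (Fin n) k) P < (c : WithBot ℕ∞)) : P ≤ dlp k n M 𝒜 c := by
  cases c with
  | zero => 
    intro x hx
    have := mDim_bot h'
    have h2 : (⟨x, hx⟩ : P) = 0 := Subsingleton.elim _ _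
    have : x = 0 := congrArg Subtype.val h2
    rw [this]; exact zero_mem _
  | succ c => exact le_dl k n M 𝒜 c P h (wb_lt _ _ h')
      

lemma dl_top (hInt : DirectSum.IsInternal 𝒜) (d c : ℕ) 
    (hd : mDim (MvPolynomial (Fin n) k) M = (d : WithBot ℕ∞)) (hc : d ≤ c) : dl k n M 𝒜 c = ⊤ := by
  rw [eq_top_iff]
  apply le_dl k n M 𝒜 c _ (gr_top k n M 𝒜 hInt)
  refine le_trans (mDim_inj (Submodule.subtype _) (Submodule.subtype_injective _)) ?_
  rw [hd]
  exact_mod_cast hc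

lemma Qd_dim (c : ℕ) : mDim (MvPolynomial (Fin n) k) (Qd k n M 𝒜 c) ≤ (c : WithBot ℕ∞) :=
  le_trans (mDim_surj _ (Submodule.mkQ_surjective _)) (dl_mem k n M 𝒜 c).2

def comapEquiv (c : ℕ) : dlp k n M 𝒜 c ≃ₗ[MvPolynomial (Fin n) k] 
    Submodule.comap (dl k n M 𝒜 c).subtype (dlp k n M 𝒜 c) :=
  (Submodule.comapSubtypeEquivOfLe (dlp_le k n M 𝒜 c)).symm

lemma Qd_dep (c : ℕ) (h : IsCM (MvPolynomial (Fin n) k) (irrIdeal k n) (Qd k n M 𝒜 c)) :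
    Dep (irrIdeal k n) c (Qd k n M 𝒜 c) := by
  apply dep_of_depth
  obtain ⟨h1, h2⟩ := h
  have h3 : (c : WithBot ℕ∞) ≤ mDim (MvPolynomial (Fin n) k) (Qd k n M 𝒜 c) := by
    by_contra hc
    rw [not_le] at hc
    have h4 : mDim (MvPolynomial (Fin n) k) (dl k n M 𝒜 c) < (c : WithBot ℕ∞) := by
      have h6 : mDim (MvPolynomial (Fin n) k) (dlp k n M 𝒜 c) ⊔ 
          mDim (MvPolynomial (Fin n) k) (Qd k n M 𝒜 c) < (c : WithBot ℕ∞) :=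
        max_lt (dlp_mem k n M 𝒜 c).2 hc
      refine lt_of_le_of_lt ?_ h6
      refine mDim_exact (Submodule.subtype_injective _) 
        (Submodule.mkQ_surjective _) (exact_sub _) _ ?_ le_sup_right
      exact le_trans (mDim_surj _ (comapEquiv k n M 𝒜 c).surjective) le_sup_left
    have h5 := le_dlp k n M 𝒜 c _ (dl_mem k n M 𝒜 c).1 h4
    have : Subsingleton (Qd k n M 𝒜 c) := by
      apply Submodule.Quotient.subsingleton_iff.2
      rw [eq_top_iff]
      intro x _
      exact h5 x.2
    exact not_subsingleton _ this
  rw [← h2] at h3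
  exact_mod_cast h3

variable [Infinite k] 

lemma Qd_ss (i : ℕ) (hscm : IsPartiallySCM k n M 𝒜 ⊥ i) (c j : ℕ) (hc : i ≤ c) (hj : j < c) :
    Subsingleton (SS (irrIdeal k n) (Qd k n M 𝒜 c) j) := by
  rcases hscm c hc with h | h
  · exact ss_zero_of_module _ _ h
  · exact ss_dep_zero c _ (Qd_dep k n M 𝒜 c h) j hj

def iso2 (j : ℕ) : SS (irrIdeal k n) (dl k n M 𝒜 j) j ≃ₗ[MvPolynomial (Fin n) k] 
    SS (irrIdeal k n) (Qd k n M 𝒜 j) j := 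
  s_iso_g (irrIdeal k n) j (Submodule.subtype_injective _) 
        (Submodule.mkQ_surjective _) (exact_sub _) 
    (by 
      apply ss_dim_zero
      exact lt_of_le_of_lt (mDim_surj _ (comapEquiv k n M 𝒜 j).surjective) (dlp_mem k n M 𝒜 j).2)
    (by
      apply ss_dim_zero
      refine lt_trans (lt_of_le_of_lt (mDim_surj _ (comapEquiv k n M 𝒜 j).surjective) (dlp_mem k n M 𝒜 j).2) ?_
      exact_mod_cast Nat.lt_succ_self j)

lemma iso1_step (i : ℕ) (hscm : IsPartiallySCM k n M 𝒜 ⊥ i) (c j : ℕ) (hc : i ≤ j) (hj : j ≤ c) :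
    Nonempty (SS (irrIdeal k n) (dl k n M 𝒜 c) j ≃ₗ[MvPolynomial (Fin n) k] 
      SS (irrIdeal k n) (dl k n M 𝒜 (c+1)) j) := by
  have e := sCongr (irrIdeal k n) (A := dlp k n M 𝒜 (c+1)) (B := Submodule.comap (dl k n M 𝒜 (c+1)).subtype (dlp k n M 𝒜 (c+1))) j (comapEquiv k n M 𝒜 (c+1))
  suffices h : Nonempty (SS (irrIdeal k n) (Submodule.comap (dl k n M 𝒜 (c+1)).subtype (dlp k n M 𝒜 (c+1))) j ≃ₗ[MvPolynomial (Fin n) k] 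
      SS (irrIdeal k n) (dl k n M 𝒜 (c+1)) j) from h.elim fun e' => ⟨LinearEquiv.trans e e'⟩
  constructor
  cases j with
  | zero => 
    exact s_iso_f0 (irrIdeal k n) (Submodule.subtype_injective _) 
        (Submodule.mkQ_surjective _) (exact_sub _) 
        (Qd_ss k n M 𝒜 i hscm (c+1) 0 (by omega) (by omega))
  | succ j =>
    exact s_iso_f (irrIdeal k n) j (Submodule.subtype_injective _) 
        (Submodule.mkQ_surjective _) (exact_sub _) 
        (Qd_ss k n M 𝒜 i hscm (c+1) j (by omega) (by omega))
        (Qd_ss k n M 𝒜 i hscm (c+1) (j+1) (by omega) (by omega))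

lemma iso1_t (i : ℕ) (hscm : IsPartiallySCM k n M 𝒜 ⊥ i) (j : ℕ) (hj : i ≤ j) (t : ℕ) :
    Nonempty (SS (irrIdeal k n) (dl k n M 𝒜 j) j ≃ₗ[MvPolynomial (Fin n) k] 
      SS (irrIdeal k n) (dl k n M 𝒜 (j+t)) j) := by
  induction t with
  | zero => exact ⟨LinearEquiv.refl _ _⟩
  | succ t ih =>
    obtain ⟨e⟩ := ih
    obtain ⟨e'⟩ := iso1_step k n M 𝒜 i hscm (j+t) j hj (by omega)
    exact ⟨e.trans e'⟩

lemma iso1 (hInt : DirectSum.IsInternal 𝒜) (d : ℕ) 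
    (hd : mDim (MvPolynomial (Fin n) k) M = (d : WithBot ℕ∞)) 
    (i : ℕ) (hscm : IsPartiallySCM k n M 𝒜 ⊥ i) (j : ℕ) (hj : i ≤ j) :
    Nonempty (SS (irrIdeal k n) M j ≃ₗ[MvPolynomial (Fin n) k] 
      SS (irrIdeal k n) (dl k n M 𝒜 j) j) := by
  obtain ⟨e⟩ := iso1_t k n M 𝒜 i hscm j hj d
  have h := dl_top k n M 𝒜 hInt d (j+d) hd (by omega)
  let e0 : dl k n M 𝒜 (j+d) ≃ₗ[MvPolynomial (Fin n) k] M := LinearEquiv.ofTop _ h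
  exact ⟨(e.trans (sCongr (irrIdeal k n) j e0)).symm⟩

end

end St15
end


noncomputable section
namespace St15
open Limits
open scoped Pointwise
set_option linter.unusedVariables false
set_option linter.unusedSectionVars false
set_option linter.unusedSimpArgs false

/-- graded modules, encoded by projections -/
structure GM (k : Type) [Field k] (n : ℕ) where
  V : Type
  [acg : AddCommGroup V]
  [mod : Module (MvPolynomial (Fin n) k) V]
  π : ℤ → V →+ V
  idem : ∀ e v, π e (π e v) = π e v
  orth : ∀ e e' v, e ≠ e' → π e (π e' v) = 0
  fin : ∀ v, ∃ s : Finset ℤ, ∑ e ∈ s, π e v = v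
  compat : ∀ (d : ℕ) (f : MvPolynomial (Fin n) k), f.IsHomogeneous d → ∀ (e : ℤ) (v : V),
    π (e + d) (f • v) = f • π e v

attribute [instance] GM.acg GM.mod

section
variable {k : Type} [Field k] {n : ℕ}

namespace GM
variable (N : GM k n)

lemma fin' (v : N.V) : ∃ s : Finset ℤ, (∀ e ∉ s, N.π e v = 0) ∧ ∑ e ∈ s, N.π e v = v := by
  obtain ⟨s, hs⟩ := N.fin v
  refine ⟨s, fun e he => ?_, hs⟩
  rw [← hs, map_sum]
  apply Finset.sum_eq_zero
  intro e' he'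
  exact N.orth _ _ _ (fun h => he (h ▸ he'))

lemma ext_pi {v w : N.V} (h : ∀ e, N.π e v = N.π e w) : v = w := by
  rw [← sub_eq_zero]
  obtain ⟨s, hs⟩ := N.fin (v - w)
  rw [← hs]
  apply Finset.sum_eq_zero
  intro e _
  rw [map_sub, h, sub_self]

lemma compat1 {x : MvPolynomial (Fin n) k} (hx : x.IsHomogeneous 1) (e : ℤ) (v : N.V) :
    N.π (e + 1) (x • v) = x • N.π e v := N.compat 1 x hx e v

lemma compat1' {x : MvPolynomial (Fin n) k} (hx : x.IsHomogeneous 1) (e : ℤ) (v : N.V) :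
    N.π e (x • v) = x • N.π (e - 1) v := by
  rw [← N.compat1 hx, sub_add_cancel]

lemma compat_pow {x : MvPolynomial (Fin n) k} (hx : x.IsHomogeneous 1) (t : ℕ) (e : ℤ) (v : N.V) :
    N.π (e + t) (x ^ t • v) = x ^ t • N.π e v := N.compat t _ (by simpa using hx.pow t) e v

/-- graded submodule -/
def sub (P : Submodule (MvPolynomial (Fin n) k) N.V) (h : ∀ e, ∀ v ∈ P, N.π e v ∈ P) : GM k n where
  V := P
  π e := { toFun := fun v => ⟨N.π e v, h e v v.2⟩
           map_zero' := by ext; simp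
           map_add' := by intros; ext; simp }
  idem e v := Subtype.ext (N.idem e v)
  orth e e' v h := Subtype.ext (N.orth e e' v h)
  fin v := by
    obtain ⟨s, hs⟩ := N.fin v.1
    refine ⟨s, Subtype.ext ?_⟩
    refine Eq.trans ?_ hs
    exact map_sum P.subtype _ _
  compat d f hf e v := Subtype.ext (N.compat d f hf e v)

/-- graded quotient -/
def quot (P : Submodule (MvPolynomial (Fin n) k) N.V) (h : ∀ e, ∀ v ∈ P, N.π e v ∈ P) : GM k n where
  V := N.V ⧸ P
  π e := QuotientAddGroup.map P.toAddSubgroup P.toAddSubgroup (N.π e) (fun v hv => h e v hv)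
  idem e v := by
    obtain ⟨v, rfl⟩ := Submodule.mkQ_surjective _ v
    exact congrArg P.mkQ (N.idem e v)
  orth e e' v h := by
    obtain ⟨v, rfl⟩ := Submodule.mkQ_surjective _ v
    exact congrArg P.mkQ (N.orth e e' v h)
  fin v := by
    obtain ⟨v, rfl⟩ := Submodule.mkQ_surjective _ v
    obtain ⟨s, hs⟩ := N.fin v
    refine ⟨s, ?_⟩
    refine Eq.trans ?_ (congrArg P.mkQ hs)
    rw [map_sum]
    rfl
  compat d f hf e v := by
    obtain ⟨v, rfl⟩ := Submodule.mkQ_surjective _ v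
    exact congrArg P.mkQ (N.compat d f hf e v)

lemma quot_pi (P : Submodule (MvPolynomial (Fin n) k) N.V) (h : ∀ e, ∀ v ∈ P, N.π e v ∈ P) (e v) :
    (N.quot P h).π e (P.mkQ v) = P.mkQ (N.π e v) := rfl

/-- filtration by degree `≥ e` -/
def ge (e : ℤ) : Submodule (MvPolynomial (Fin n) k) N.V where
  carrier := {v | ∀ e' < e, N.π e' v = 0}
  zero_mem' := by intro e' _; simp
  add_mem' := by intro a b ha hb e' h; rw [map_add, ha e' h, hb e' h, add_zero]
  smul_mem' := by
    intro f v hv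
    induction f using MvPolynomial.induction_on with
    | C a => 
      intro e' h
      have := N.compat 0 (MvPolynomial.C a) (MvPolynomial.isHomogeneous_C _ a) e' v
      simp only [Nat.cast_zero, add_zero] at this
      rw [this, hv e' h, smul_zero]
    | add p q hp hq =>
      intro e' h
      rw [add_smul, map_add, hp e' h, hq e' h, add_zero]
    | mul_X p i hp =>
      intro e' h
      rw [mul_comm, mul_smul, N.compat1' (MvPolynomial.isHomogeneous_X k i), hp _ (by omega), smul_zero]

lemma mem_ge {e : ℤ} {v : N.V} : v ∈ N.ge e ↔ ∀ e' < e, N.π e' v = 0 := Iff.rfl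

lemma ge_smul {e : ℤ} {v : N.V} (hv : v ∈ N.ge e) {r} (hr : r ∈ irrIdeal k n) : r • v ∈ N.ge (e+1) := by
  unfold irrIdeal at hr
  induction hr using Submodule.span_induction with
  | mem x h => 
    obtain ⟨i, rfl⟩ := h
    intro e' h
    rw [N.compat1' (MvPolynomial.isHomogeneous_X k i), hv _ (by omega), smul_zero]
  | zero => simp
  | add x y _ _ hx hy => rw [add_smul]; exact add_mem hx hy
  | smul c x _ hx => rw [smul_assoc]; exact Submodule.smul_mem _ _ hx

lemma ge_pow {e : ℤ} {v : N.V} (t : ℕ) (hv : v ∈ N.ge e) {r} (hr : r ∈ irrIdeal k n ^ t) : 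
    r • v ∈ N.ge (e+t) := by
  induction t generalizing r with
  | zero => simpa using Submodule.smul_mem _ _ hv
  | succ t ih =>
    rw [pow_succ'] at hr
    refine Submodule.mul_induction_on hr ?_ ?_
    · intro a ha b hb
      rw [mul_smul]
      have := N.ge_smul (ih hb) ha
      rwa [add_assoc] at this
    · intro a b ha hb
      rw [add_smul]; exact add_mem ha hb

def BddAbv : Prop := ∃ b : ℤ, ∀ e ≥ b, ∀ v, N.π e v = 0

lemma BddAbv.isTor (h : N.BddAbv) : IsTor (irrIdeal k n) N.V := by
  intro v
  obtain ⟨b, hb⟩ := h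
  obtain ⟨s, hs, -⟩ := N.fin' v
  obtain ⟨e0, he0⟩ : ∃ e0 : ℤ, v ∈ N.ge e0 := by
    by_cases hne : s.Nonempty
    · refine ⟨s.min' hne, fun e' h => hs e' fun h2 => ?_⟩
      have := s.min'_le e' h2
      omega
    · refine ⟨0, fun e' h => hs e' fun h2 => hne ⟨_, h2⟩⟩
  refine ⟨(b - e0).toNat, fun r hr => ?_⟩
  have h1 := N.ge_pow _ he0 hr
  apply N.ext_pi
  intro e
  rw [map_zero]
  by_cases h2 : b ≤ e
  · exact hb e h2 _
  · exact h1 e (by omega)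

lemma bddAbv_of_artinian [IsArtinian (MvPolynomial (Fin n) k) N.V] : N.BddAbv := by
  have hanti : ∀ {a b : ℤ}, a ≤ b → N.ge b ≤ N.ge a := fun h v hv e he => hv e (by omega)
  obtain ⟨t, ht⟩ := IsArtinian.monotone_stabilizes (R := MvPolynomial (Fin n) k) (M := N.V)
    ⟨fun t : ℕ => OrderDual.toDual (N.ge t), fun a b h => hanti (by exact_mod_cast h)⟩
  refine ⟨t, fun e he v => ?_⟩
  have h1 : N.ge e.toNat = N.ge (e.toNat + 1 : ℕ) := 
    (ht e.toNat (by omega)).symm.trans (ht (e.toNat + 1) (by omega))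
  have h2 : N.π e v ∈ N.ge e.toNat := by
    intro e' h
    exact N.orth _ _ _ (by omega)
  rw [h1] at h2
  have := h2 e (by omega)
  rwa [N.idem] at this

end GM
end

section
variable {R : Type} [CommRing R] [IsNoetherianRing R]
lemma artin_of_dim (Q : Type) [AddCommGroup Q] [Module R Q] [Module.Finite R Q]
    (h : mDim R Q ≤ ((0:ℕ) : WithBot ℕ∞)) : IsArtinian R Q := by
  change Module.supportDim R Q ≤ _ at h
  rw [Module.supportDim_eq_ringKrullDim_quotient_annihilator] at h
  have h1 : Ring.KrullDimLE 0 (R ⧸ Module.annihilator R Q) := by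
    rw [Ring.krullDimLE_iff]; exact h
  have h2 : IsArtinianRing (R ⧸ Module.annihilator R Q) := 
    isArtinianRing_iff_isNoetherianRing_krullDimLE_zero.2 ⟨inferInstance, h1⟩
  letI : Module (R ⧸ Module.annihilator R Q) Q := Module.IsTorsionBySet.module (I := Module.annihilator R Q)
    (Module.isTorsionBySet_annihilator R Q) 
  haveI : IsScalarTower R (R ⧸ Module.annihilator R Q) Q := 
    Module.IsTorsionBySet.isScalarTower _
  have : Module.Finite (R ⧸ Module.annihilator R Q) Q := Module.Finite.of_restrictScalars_finite R _ _
  have h3 : IsArtinian (R ⧸ Module.annihilator R Q) Q := inferInstance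
  exact isArtinian_of_surjective_algebraMap (R := R ⧸ Module.annihilator R Q) (Ideal.Quotient.mk_surjective)
end

end St15
end


noncomputable section
namespace St15
open Limits
open scoped Pointwise
set_option linter.unusedVariables false
set_option linter.unusedSectionVars false
set_option linter.unusedSimpArgs false

variable {k : Type} [Field k] {n : ℕ}

/-- `D` is a model of `N_x / N` -/
structure DD (x : MvPolynomial (Fin n) k) (N D : GM k n) where
  φ : ℕ → N.V →ₗ[MvPolynomial (Fin n) k] D.V
  φ_succ : ∀ t v, φ (t+1) (x • v) = φ t v
  φ_zero : ∀ v, φ 0 v = 0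
  surj : ∀ w, ∃ t v, φ t v = w
  ker : ∀ t v, φ t v = 0 → ∃ w, v = x ^ t • w
  gr : ∀ e t v, D.π e (φ t v) = φ t (N.π (e + t) v)
  ss : ∀ j, Nonempty (SS (irrIdeal k n) N.V (j+1) ≃ₗ[MvPolynomial (Fin n) k] SS (irrIdeal k n) D.V j)

namespace DD
variable {x : MvPolynomial (Fin n) k} {N D : GM k n} (h : DD x N D)
include h

lemma φ_add (t u : ℕ) (v) : h.φ (t + u) (x ^ u • v) = h.φ t v := by
  induction u generalizing v with
  | zero => simp
  | succ u ih => rw [pow_succ', mul_smul, ← add_assoc, h.φ_succ, ih]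

lemma φ_self (t : ℕ) (v) : h.φ t (x ^ t • v) = 0 := by
  have := h.φ_add 0 t v
  rwa [zero_add, h.φ_zero] at this

lemma surj2 (w w') : ∃ t v v', h.φ t v = w ∧ h.φ t v' = w' := by
  obtain ⟨t, v, rfl⟩ := h.surj w
  obtain ⟨s, v', rfl⟩ := h.surj w'
  exact ⟨t + s, x ^ s • v, x ^ t • v', h.φ_add _ _ _, by rw [add_comm, h.φ_add]⟩

/-- lifting -/
lemma lift {Z : Type} [AddCommGroup Z] [Module (MvPolynomial (Fin n) k) Z] 
    (g : ℕ → N.V →ₗ[MvPolynomial (Fin n) k] Z) (g_succ : ∀ t v, g (t+1) (x • v) = g t v)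
    (g_zero : ∀ v, g 0 v = 0) : ∃ G : D.V →ₗ[MvPolynomial (Fin n) k] Z, ∀ t v, G (h.φ t v) = g t v := by
  have g_add : ∀ (t u : ℕ) (v), g (t + u) (x ^ u • v) = g t v := by
    intro t u v
    induction u generalizing v with
    | zero => simp
    | succ u ih => rw [pow_succ', mul_smul, ← add_assoc, g_succ, ih]
  choose T V hV using h.surj
  have key : ∀ t v, g (T (h.φ t v)) (V (h.φ t v)) = g t v := by
    intro t v
    have h1 := hV (h.φ t v)
    generalize T (h.φ t v) = T' at *
    generalize V (h.φ t v) = V' at *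
    rw [← h.φ_add _ t, ← h.φ_add t (T') v, add_comm t, ← sub_eq_zero, ← map_sub] at h1
    obtain ⟨w, hw⟩ := h.ker _ _ h1
    rw [← g_add _ t, ← g_add t (T') v, add_comm t, ← sub_eq_zero, ← map_sub, hw]
    have := g_add 0 (T' + t) w
    rwa [zero_add, g_zero] at this
  refine ⟨{ toFun := fun w => g (T w) (V w), map_add' := ?_, map_smul' := ?_ }, key⟩
  · intro w w'
    obtain ⟨t, v, v', rfl, rfl⟩ := h.surj2 w w'
    rw [← map_add, key, key, key, map_add]
  · intro r w
    obtain ⟨t, v, rfl⟩ := h.surj w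
    rw [← map_smul, key, key, map_smul]; rfl
end DD

section construct
variable (x : MvPolynomial (Fin n) k) (N : GM k n)

abbrev Loc := LocalizedModule (Submonoid.powers x) N.V

def Rng : Submodule (MvPolynomial (Fin n) k) (Loc x N) := 
  LinearMap.range (LocalizedModule.mkLinearMap (Submonoid.powers x) N.V)

abbrev DV := Loc x N ⧸ Rng x N

def psi (t : ℕ) : N.V →ₗ[MvPolynomial (Fin n) k] Loc x N :=
  { toFun := fun v => LocalizedModule.mk v ⟨x ^ t, t, rfl⟩
    map_add' := by
      intro a b
      rw [LocalizedModule.mk_add_mk, LocalizedModule.mk_eq]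
      refine ⟨1, ?_⟩
      simp only [one_smul, Submonoid.smul_def, Submonoid.coe_mul]
      simp only [smul_add, smul_smul]
    map_smul' := by
      intro r a
      rw [RingHom.id_apply, LocalizedModule.smul'_mk] }

def dphi (t : ℕ) : N.V →ₗ[MvPolynomial (Fin n) k] DV x N := (Rng x N).mkQ ∘ₗ psi x N t

lemma psi_succ (t v) : psi x N (t+1) (x • v) = psi x N t v := by
  change LocalizedModule.mk _ _ = LocalizedModule.mk _ _
  rw [LocalizedModule.mk_eq]
  refine ⟨1, ?_⟩
  simp only [one_smul, Submonoid.smul_def]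
  rw [smul_smul, pow_succ]

lemma dphi_succ (t v) : dphi x N (t+1) (x • v) = dphi x N t v := 
  congrArg (Rng x N).mkQ (psi_succ x N t v)

lemma dphi_zero (v) : dphi x N 0 v = 0 := by
  change (Rng x N).mkQ _ = 0
  rw [Submodule.mkQ_apply, Submodule.Quotient.mk_eq_zero]
  refine ⟨v, ?_⟩
  change LocalizedModule.mk _ _ = LocalizedModule.mk _ _
  congr 1

lemma dphi_surj (w) : ∃ t v, dphi x N t v = w := by
  obtain ⟨w, rfl⟩ := Submodule.mkQ_surjective _ w
  induction w using LocalizedModule.induction_on with | _ v s =>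
  obtain ⟨_, t, rfl⟩ := s
  exact ⟨t, v, rfl⟩

variable {x}
lemma reg_pow (hx : IsSMulRegular N.V x) (t : ℕ) {v : N.V} (h : x ^ t • v = 0) : v = 0 := 
  (hx.pow t) (h.trans (smul_zero _).symm)

lemma dphi_ker (hx : IsSMulRegular N.V x) (t v) (h : dphi x N t v = 0) : ∃ w, v = x ^ t • w := by
  change (Rng x N).mkQ _ = 0 at h
  rw [Submodule.mkQ_apply, Submodule.Quotient.mk_eq_zero] at h
  obtain ⟨w, hw⟩ := h
  change LocalizedModule.mk _ _ = LocalizedModule.mk _ _ at hw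
  rw [LocalizedModule.mk_eq] at hw
  obtain ⟨⟨_, u, rfl⟩, hu⟩ := hw
  simp only [one_smul, Submonoid.smul_def] at hu
  refine ⟨w, ?_⟩
  rw [← sub_eq_zero, ← smul_sub] at hu
  have := reg_pow N hx u hu
  rw [sub_eq_zero] at this
  exact this.symm

lemma mkLin_inj (hx : IsSMulRegular N.V x) : 
    Function.Injective (LocalizedModule.mkLinearMap (Submonoid.powers x) N.V) := by
  rw [injective_iff_map_eq_zero]
  intro v hv
  rw [LocalizedModule.mkLinearMap_apply, ← LocalizedModule.zero_mk 1, LocalizedModule.mk_eq] at hv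
  obtain ⟨⟨_, u, rfl⟩, hu⟩ := hv
  simp only [one_smul, Submonoid.smul_def, smul_zero] at hu
  exact reg_pow N hx u hu

lemma loc_bij : Function.Bijective (fun a : Loc x N => x • a) := by
  have := (IsLocalizedModule.map_units (S := Submonoid.powers x) 
    (LocalizedModule.mkLinearMap (Submonoid.powers x) N.V) ⟨x, Submonoid.mem_powers x⟩)
  exact (Module.End.isUnit_iff _).1 this

lemma dss (hxm : x ∈ irrIdeal k n) (hx : IsSMulRegular N.V x) (j : ℕ) : 
    Nonempty (SS (irrIdeal k n) N.V (j+1) ≃ₗ[MvPolynomial (Fin n) k] SS (irrIdeal k n) (DV x N) j) := 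
  ⟨(s_iso_shift (irrIdeal k n) j (mkLin_inj N hx) (Submodule.mkQ_surjective (Rng x N)) (by
    intro y
    rw [Submodule.mkQ_apply, Submodule.Quotient.mk_eq_zero]
    rfl) (ss_zero_of_bij _ _ x hxm (loc_bij N)) (ss_zero_of_bij _ _ x hxm (loc_bij N))).symm⟩

lemma dphi_add (t u : ℕ) (v) : dphi x N (t + u) (x ^ u • v) = dphi x N t v := by
  induction u generalizing v with
  | zero => simp
  | succ u ih => rw [pow_succ', mul_smul, ← add_assoc, dphi_succ, ih]

lemma dphi_self (t : ℕ) (v) : dphi x N t (x ^ t • v) = 0 := by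
  have := dphi_add (x := x) N 0 t v
  rwa [zero_add, dphi_zero] at this

lemma dpi_exists (hh : x.IsHomogeneous 1) (hx : IsSMulRegular N.V x) (e : ℤ) : 
    ∃ p : DV x N →+ DV x N, ∀ t v, p (dphi x N t v) = dphi x N t (N.π (e + t) v) := by
  choose T V hV using dphi_surj x N
  have key : ∀ t v, dphi x N (T (dphi x N t v)) (N.π (e + T (dphi x N t v)) (V (dphi x N t v))) = 
      dphi x N t (N.π (e + t) v) := by
    intro t v
    have h1 := hV (dphi x N t v)
    generalize T (dphi x N t v) = T' at *
    generalize V (dphi x N t v) = V' at *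
    rw [← dphi_add N _ t, ← dphi_add N t T' v, add_comm t, ← sub_eq_zero, ← map_sub] at h1
    obtain ⟨w, hw⟩ := dphi_ker N hx _ _ h1
    rw [← dphi_add N _ t, ← dphi_add N t T', add_comm t T', ← sub_eq_zero, ← map_sub]
    rw [← N.compat_pow hh, ← N.compat_pow hh]
    have h2 : N.π (e + T' + t) (x ^ t • V') - N.π (e + t + T') (x ^ T' • v) = x ^ (T' + t) • N.π e w := by
      rw [← N.compat_pow hh, ← hw, map_sub]
      congr 2 <;> congr 1 <;> push_cast <;> ring
    rw [h2, dphi_self]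
  refine ⟨{ toFun := fun w => dphi x N (T w) (N.π (e + T w) (V w)), map_add' := ?_, map_zero' := ?_ }, key⟩
  · have := key 0 0
    simpa using this
  · intro w w'
    obtain ⟨t, v, rfl⟩ := dphi_surj x N w
    obtain ⟨s, v', rfl⟩ := dphi_surj x N w'
    have e1 : dphi x N t v = dphi x N (t + s) (x ^ s • v) := (dphi_add N _ _ _).symm
    have e2 : dphi x N s v' = dphi x N (t + s) (x ^ t • v') := by rw [add_comm, dphi_add N]
    rw [e1, e2, ← map_add, key, key, key, map_add, map_add]

def dpi (hh : x.IsHomogeneous 1) (hx : IsSMulRegular N.V x) (e : ℤ) : DV x N →+ DV x N := 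
  (dpi_exists N hh hx e).choose

lemma dpi_phi (hh : x.IsHomogeneous 1) (hx : IsSMulRegular N.V x) (e : ℤ) (t v) : 
   dpi N hh hx e (dphi x N t v) = dphi x N t (N.π (e + t) v) := (dpi_exists N hh hx e).choose_spec t v

def DG (hh : x.IsHomogeneous 1) (hx : IsSMulRegular N.V x) : GM k n where
  V := DV x N
  π := dpi N hh hx
  idem e w := by
    obtain ⟨t, v, rfl⟩ := dphi_surj x N w
    rw [dpi_phi, dpi_phi, N.idem]
  orth e e' w h := by
    obtain ⟨t, v, rfl⟩ := dphi_surj x N w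
    rw [dpi_phi, dpi_phi, N.orth _ _ _ (by omega), map_zero]
  fin w := by
    obtain ⟨t, v, rfl⟩ := dphi_surj x N w
    obtain ⟨s, hs⟩ := N.fin v
    refine ⟨s.map (Equiv.subRight (t : ℤ)).toEmbedding, ?_⟩
    rw [Finset.sum_map]
    simp only [dpi_phi]
    conv_rhs => rw [← hs]
    rw [map_sum]
    apply Finset.sum_congr rfl
    intro e _
    simp
  compat d f hf e w := by
    obtain ⟨t, v, rfl⟩ := dphi_surj x N w
    rw [← map_smul, dpi_phi, dpi_phi, ← map_smul, ← N.compat d f hf]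
    congr 2
    ring_nf

def DGD (hh : x.IsHomogeneous 1) (hxm : x ∈ irrIdeal k n) (hx : IsSMulRegular N.V x) : 
    DD x N (DG N hh hx) where
  φ := dphi x N
  φ_succ := dphi_succ x N
  φ_zero := dphi_zero x N
  surj := dphi_surj x N
  ker := dphi_ker N hx
  gr := dpi_phi N hh hx
  ss := dss N hxm hx
end construct

/-- exact sequences `0 → K → D → D → 0` -/
structure Trip (x : MvPolynomial (Fin n) k) (K D : GM k n) where
  ι : K.V →ₗ[MvPolynomial (Fin n) k] D.V
  inj : Function.Injective ι
  zero : ∀ v, x • ι v = 0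
  ex : ∀ w, x • w = 0 → ∃ v, ι v = w
  sur : ∀ w : D.V, ∃ w', x • w' = w
  nil : ∀ w : D.V, ∃ t : ℕ, x ^ t • w = 0
  gr : ∀ e v, D.π e (ι v) = ι (K.π (e + 1) v)

lemma Trip.reg {x y : MvPolynomial (Fin n) k} {K D : GM k n} (h : Trip x K D) (hy : IsSMulRegular K.V y) :
    IsSMulRegular D.V y := by
  have key : ∀ t : ℕ, ∀ w : D.V, x ^ t • w = 0 → y • w = 0 → w = 0 := by
    intro t
    induction t with
    | zero => intro w hw _; simpa using hw
    | succ t ih =>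
      intro w hw hyw
      apply ih w _ hyw
      rw [pow_succ', mul_smul] at hw
      obtain ⟨v, hv⟩ := h.ex _ hw
      have : y • v = 0 := by
        apply h.inj
        rw [map_smul, hv, map_zero, smul_comm, hyw, smul_zero]
      have : v = 0 := hy (this.trans (smul_zero _).symm)
      rw [← hv, this, map_zero]
  intro w w' hw
  rw [← sub_eq_zero]
  obtain ⟨t, ht⟩ := h.nil (w - w')
  apply key t _ ht
  rw [smul_sub]
  exact sub_eq_zero.2 hw

lemma Trip.step {x y : MvPolynomial (Fin n) k} {K D K' : GM k n} (h : Trip x K D) 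
    (hh : y.IsHomogeneous 1) (hym : y ∈ irrIdeal k n) (hy : IsSMulRegular K.V y) (hK : DD y K K') : 
    ∃ D', Nonempty (DD y D D') ∧ Nonempty (Trip x K' D') := by
  have hyD := h.reg hy
  refine ⟨DG D hh hyD, ⟨DGD D hh hym hyD⟩, ?_⟩
  generalize DG D hh hyD = D', DGD D hh hym hyD = hD
  obtain ⟨G, hG⟩ := hK.lift (fun t => hD.φ t ∘ₗ h.ι) (by
    intro t v
    rw [LinearMap.comp_apply, LinearMap.comp_apply, map_smul h.ι, hD.φ_succ]) (by
    intro v; exact hD.φ_zero _)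
  simp only [LinearMap.comp_apply] at hG
  refine ⟨⟨G, ?_, ?_, ?_, ?_, ?_, ?_⟩⟩
  · rw [injective_iff_map_eq_zero]
    intro w hw
    obtain ⟨t, v, rfl⟩ := hK.surj w
    rw [hG] at hw
    obtain ⟨w, hw⟩ := hD.ker _ _ hw
    have h1 : x • w = 0 := by
      apply reg_pow D hyD t
      rw [smul_comm, ← hw, h.zero]
    obtain ⟨w', rfl⟩ := h.ex _ h1
    rw [← map_smul] at hw
    rw [h.inj hw, hK.φ_self]
  · intro w
    obtain ⟨t, v, rfl⟩ := hK.surj w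
    rw [hG, ← map_smul, h.zero, map_zero]
  · intro w hw
    obtain ⟨t, v, rfl⟩ := hD.surj w
    rw [← map_smul] at hw
    obtain ⟨w, hw⟩ := hD.ker _ _ hw
    obtain ⟨u, rfl⟩ := h.sur w
    rw [smul_comm, ← sub_eq_zero, ← smul_sub] at hw
    obtain ⟨a, ha⟩ := h.ex _ hw
    refine ⟨hK.φ t a, ?_⟩
    rw [hG, ha, map_sub, hD.φ_self, sub_zero]
  · intro w
    obtain ⟨t, v, rfl⟩ := hD.surj w
    obtain ⟨u, rfl⟩ := h.sur v
    exact ⟨hD.φ t u, by rw [map_smul]⟩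
  · intro w
    obtain ⟨t, v, rfl⟩ := hD.surj w
    obtain ⟨s, hs⟩ := h.nil v
    exact ⟨s, by rw [← map_smul, hs, map_zero]⟩
  · intro e w
    obtain ⟨t, v, rfl⟩ := hK.surj w
    rw [hG, hD.gr, h.gr, hK.gr, hG]
    congr 3
    ring_nf

inductive Tower : ℕ → GM k n → GM k n → Prop
  | nil (N : GM k n) : Tower 0 N N
  | cons (q : ℕ) (y : MvPolynomial (Fin n) k) (N D V : GM k n) (hh : y.IsHomogeneous 1) (hym : y ∈ irrIdeal k n)
     (hy : IsSMulRegular N.V y) (hD : Nonempty (DD y N D)) (hT : Tower q D V) : Tower (q+1) N V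

lemma Tower.ss {q : ℕ} {N V : GM k n} (h : Tower q N V) : 
    Nonempty (SS (irrIdeal k n) N.V q ≃ₗ[MvPolynomial (Fin n) k] SS (irrIdeal k n) V.V 0) := by
  induction h with
  | nil N => exact ⟨LinearEquiv.refl _ _⟩
  | cons q y N D V hh hym hy hD hT ih =>
    obtain ⟨hD⟩ := hD
    obtain ⟨e⟩ := hD.ss q
    obtain ⟨e'⟩ := ih
    exact ⟨e.trans e'⟩

lemma Tower.trip {x : MvPolynomial (Fin n) k} {q : ℕ} {K K' : GM k n} (h : Tower q K K') : 
    ∀ D, Nonempty (Trip x K D) → ∃ D', Tower q D D' ∧ Nonempty (Trip x K' D') := by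
  induction h with
  | nil N => intro D hD; exact ⟨D, Tower.nil D, hD⟩
  | cons q y N D V hh hym hy hD hT ih =>
    rintro E ⟨hE⟩
    obtain ⟨hD⟩ := hD
    obtain ⟨E1, hE1, hE2⟩ := hE.step hh hym hy hD
    obtain ⟨E', h1, h2⟩ := ih E1 hE2
    exact ⟨E', Tower.cons q y E E1 E' hh hym (hE.reg hy) hE1 h1, h2⟩

end St15
end


noncomputable section
namespace St15
open Limits
open scoped Pointwise
set_option linter.unusedVariables false
set_option linter.unusedSectionVars false
set_option linter.unusedSimpArgs false

variable {k : Type} [Field k] {n : ℕ}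

instance GM.modk (N : GM k n) : Module k N.V := 
  Module.compHom N.V (MvPolynomial.C : k →+* MvPolynomial (Fin n) k)

lemma GM.smul_def (N : GM k n) (a : k) (v : N.V) : a • v = (MvPolynomial.C a : MvPolynomial (Fin n) k) • v := rfl

instance GM.towk (N : GM k n) : IsScalarTower k (MvPolynomial (Fin n) k) N.V := 
  ⟨fun a f v => by rw [GM.smul_def, MvPolynomial.smul_eq_C_mul, mul_smul]⟩

lemma GM.pi_smul (N : GM k n) (e : ℤ) (a : k) (v : N.V) : N.π e (a • v) = a • N.π e v := by
  have := N.compat 0 (MvPolynomial.C a) (MvPolynomial.isHomogeneous_C _ a) e v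
  simp only [Nat.cast_zero, add_zero] at this
  exact this

def GM.piece (N : GM k n) (e : ℤ) : Submodule k N.V where
  carrier := {v | N.π e v = v}
  zero_mem' := map_zero _
  add_mem' := by
    intro a b ha hb
    change N.π e _ = _
    rw [map_add]
    exact congrArg₂ _ ha hb
  smul_mem' := by
    intro a v hv
    change N.π e _ = _
    rw [N.pi_smul]
    exact congrArg _ hv

lemma GM.mem_piece {N : GM k n} {e : ℤ} {v : N.V} : v ∈ N.piece e ↔ N.π e v = v := Iff.rfl

def GM.hf (N : GM k n) (e : ℤ) : ℤ := Module.finrank k (N.piece e)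

def GM.fd (N : GM k n) : Prop := ∀ e, Module.Finite k (N.piece e)

section ses
variable {A B C : GM k n} (f : A.V →ₗ[MvPolynomial (Fin n) k] B.V) (g : B.V →ₗ[MvPolynomial (Fin n) k] C.V)
  (a b c : ℤ) (hf : Function.Injective f) (hg : Function.Surjective g) (h0 : ∀ v, g (f v) = 0)
  (hex : ∀ v, g v = 0 → ∃ w, f w = v) (gf : ∀ v, B.π b (f v) = f (A.π a v)) 
  (gg : ∀ v, C.π c (g v) = g (B.π b v))

def fe (gf : ∀ v, B.π b (f v) = f (A.π a v)) : A.piece a →ₗ[k] B.piece b := 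
  (f.restrictScalars k).restrict (fun v hv => by
    change B.π b (f v) = f v
    rw [gf]
    exact congrArg f hv)

include hf in
lemma fe_inj : Function.Injective (fe f a b gf) := by
  intro v w h
  apply Subtype.ext
  apply hf
  exact congrArg Subtype.val h

include hg in
lemma fe_surj : Function.Surjective (fe g b c gg) := by
  rintro ⟨v, hv⟩
  obtain ⟨w, rfl⟩ := hg v
  refine ⟨⟨B.π b w, B.idem _ _⟩, Subtype.ext ?_⟩
  change g (B.π b w) = g w
  rw [← gg]; exact hv

include h0 hex in
lemma fe_exact : Function.Exact (fe f a b gf) (fe g b c gg) := by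
  rintro ⟨v, hv⟩
  constructor
  · intro h
    obtain ⟨w, hw⟩ := hex v (congrArg Subtype.val h)
    refine ⟨⟨A.π a w, A.idem _ _⟩, Subtype.ext ?_⟩
    change f (A.π a w) = v
    rw [← gf, hw]; exact hv
  · rintro ⟨w, hw⟩
    rw [← hw]
    apply Subtype.ext
    exact h0 _

include hf hg h0 hex gf gg in
lemma ses_rank (hb : Module.Finite k (B.piece b)) : 
    (Module.finrank k (B.piece b) : ℤ) = Module.finrank k (A.piece a) + Module.finrank k (C.piece c) := by
  have h1 := LinearMap.finrank_range_add_finrank_ker (fe g b c gg)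
  rw [(fe_exact f g a b c h0 hex gf gg).linearMap_ker_eq, LinearMap.finrank_range_of_inj (fe_inj f a b hf gf),
    LinearMap.range_eq_top.2 (fe_surj g b c hg gg), finrank_top] at h1
  omega

include hf hg h0 hex gf gg in
lemma ses_fin (ha : Module.Finite k (A.piece a)) (hc : Module.Finite k (C.piece c)) : 
    Module.Finite k (B.piece b) := 
  Module.Finite.of_exact  (fe_exact f g a b c h0 hex gf gg) (fe_surj g b c hg gg)

include hg gg in
lemma ses_fin_c (hb : Module.Finite k (B.piece b)) : Module.Finite k (C.piece c) := 
  Module.Finite.of_surjective _ (fe_surj g b c hg gg)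

end ses

def xl (N : GM k n) (x : MvPolynomial (Fin n) k) : N.V →ₗ[MvPolynomial (Fin n) k] N.V := 
  LinearMap.lsmul _ _ x

lemma xl_apply (N : GM k n) (x) (v) : xl N x v = x • v := rfl

lemma linForm_homog (a : Fin n → k) : (linForm k n a).IsHomogeneous 1 := by
  apply MvPolynomial.IsHomogeneous.sum
  intro i _
  exact (MvPolynomial.isHomogeneous_C_mul_X (a i) i)

section quo
variable (Q : GM k n) {x : MvPolynomial (Fin n) k} (hh : x.IsHomogeneous 1)

include hh in
lemma gr_smul : ∀ e, ∀ v ∈ (x • ⊤ : Submodule (MvPolynomial (Fin n) k) Q.V), 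
    Q.π e v ∈ (x • ⊤ : Submodule (MvPolynomial (Fin n) k) Q.V) := by
  intro e v hv
  obtain ⟨w, -, rfl⟩ := (Submodule.mem_smul_pointwise_iff_exists _ _ _).1 hv
  rw [Q.compat1' hh]
  exact (Submodule.mem_smul_pointwise_iff_exists _ _ _).2 ⟨_, trivial, rfl⟩

def KQ : GM k n := Q.quot (x • ⊤) (gr_smul Q hh)

def kq : Q.V →ₗ[MvPolynomial (Fin n) k] (KQ Q hh).V := Submodule.mkQ (x • ⊤ : Submodule (MvPolynomial (Fin n) k) Q.V)

lemma kq_surj : Function.Surjective (kq Q hh) := Submodule.mkQ_surjective _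

lemma kq_zero (v) : kq Q hh v = 0 ↔ ∃ w, x • w = v := by
  change Submodule.Quotient.mk v = 0 ↔ _
  rw [Submodule.Quotient.mk_eq_zero, Submodule.mem_smul_pointwise_iff_exists]
  simp

lemma KK_fd (h : Q.fd) : (KQ Q hh).fd := fun e => 
  ses_fin_c (kq Q hh) e e (kq_surj Q hh) (fun v => rfl) (h e)

lemma KK_hf (hx : IsSMulRegular Q.V x) (h : Q.fd) (e : ℤ) : (KQ Q hh).hf e = Q.hf e - Q.hf (e-1) := by
  have := ses_rank (xl Q x) (kq Q hh) (e-1) e e hx (kq_surj Q hh) (fun v => (kq_zero Q hh _).2 ⟨v, rfl⟩)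
    (fun v hv => (kq_zero Q hh _).1 hv) (fun v => Q.compat1' hh e v) (fun v => rfl) (h e)
  unfold GM.hf
  omega

lemma KK_trip {D : GM k n} (h : DD x Q D) : Nonempty (Trip x (KQ Q hh) D) := by
  have hle : (x • ⊤ : Submodule (MvPolynomial (Fin n) k) Q.V) ≤ LinearMap.ker (h.φ 1) := by
    intro v hv
    obtain ⟨w, -, rfl⟩ := (Submodule.mem_smul_pointwise_iff_exists _ _ _).1 hv
    rw [LinearMap.mem_ker, h.φ_succ, h.φ_zero]
  obtain ⟨ι, hι⟩ : ∃ ι : (KQ Q hh).V →ₗ[MvPolynomial (Fin n) k] D.V, ∀ v, ι (kq Q hh v) = h.φ 1 v := 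
    ⟨Submodule.liftQ _ (h.φ 1) hle, fun v => Submodule.liftQ_apply _ _ _⟩
  refine ⟨⟨ι, ?_, ?_, ?_, ?_, ?_, ?_⟩⟩
  · rw [injective_iff_map_eq_zero]
    intro w hw
    obtain ⟨v, rfl⟩ := kq_surj Q hh w
    rw [hι] at hw
    obtain ⟨w, hw⟩ := h.ker _ _ hw
    exact (kq_zero Q hh _).2 ⟨w, by rw [hw, pow_one]⟩
  · intro w
    obtain ⟨v, rfl⟩ := kq_surj Q hh w
    rw [hι, ← map_smul, h.φ_succ, h.φ_zero]
  · intro w hw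
    obtain ⟨t, v, rfl⟩ := h.surj w
    cases t with
    | zero => exact ⟨0, by rw [map_zero, h.φ_zero]⟩
    | succ t =>
      rw [← map_smul, h.φ_succ] at hw
      obtain ⟨w, rfl⟩ := h.ker _ _ hw
      exact ⟨kq Q hh w, by rw [hι, add_comm, h.φ_add]⟩
  · intro w
    obtain ⟨t, v, rfl⟩ := h.surj w
    exact ⟨h.φ (t+1) v, by rw [← map_smul, h.φ_succ]⟩
  · intro w
    obtain ⟨t, v, rfl⟩ := h.surj w
    exact ⟨t, by rw [← map_smul, h.φ_self]⟩
  · intro e w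
    obtain ⟨v, rfl⟩ := kq_surj Q hh w
    rw [hι, h.gr, ← hι]
    rfl
end quo

section trip
variable {x : MvPolynomial (Fin n) k} (hh : x.IsHomogeneous 1) {K D : GM k n} (h : Trip x K D)
include hh h

lemma Trip.bdd (hK : K.BddAbv) : D.BddAbv := by
  obtain ⟨b, hb⟩ := hK
  refine ⟨b, ?_⟩
  have key : ∀ t : ℕ, ∀ e ≥ b, ∀ w, D.π e w = w → x ^ t • w = 0 → w = 0 := by
    intro t
    induction t with
    | zero => intro e he w hw h; simpa using h
    | succ t ih =>
      intro e he w hw hx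
      rw [pow_succ, mul_smul] at hx
      have h1 : x • w = 0 := ih (e+1) (by omega) _ (by rw [D.compat1 hh, hw]) hx
      obtain ⟨v, rfl⟩ := h.ex _ h1
      rw [← hw, h.gr, hb _ (by omega), map_zero]
  intro e he v
  obtain ⟨t, ht⟩ := h.nil (D.π e v)
  exact key t e he _ (D.idem _ _) ht

lemma Trip.fdD (hK : K.fd) (hD : D.BddAbv) : D.fd := by
  obtain ⟨b, hb⟩ := hD
  have key : ∀ m : ℕ, ∀ e ≥ b - m, Module.Finite k (D.piece e) := by
    intro m
    induction m with
    | zero =>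
      intro e he
      have : Subsingleton (D.piece e) := by
        refine subsingleton_of_forall_eq 0 ?_
        rintro ⟨v, hv⟩
        apply Subtype.ext
        exact (show D.π e v = v from hv).symm.trans (hb e (by simpa using he) v)
      infer_instance
    | succ m ih =>
      intro e he
      exact ses_fin h.ι (xl D x) (e+1) e (e+1) h.inj h.sur h.zero h.ex (h.gr e) (fun v => D.compat1 hh e v)
        (hK _) (ih (e+1) (by push_cast at he; omega))
  intro e
  exact key (b - e).toNat e (by omega)

lemma Trip.hfD (hD : D.fd) (e : ℤ) : K.hf e = - (D.hf e - D.hf (e - 1)) := by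
  have := ses_rank h.ι (xl D x) (e-1+1) (e-1) (e-1+1) h.inj h.sur h.zero h.ex (h.gr (e-1)) (fun v => D.compat1 hh (e-1) v) (hD _)
  rw [sub_add_cancel] at this
  unfold GM.hf
  omega
end trip

def nab (h : ℤ → ℤ) : ℤ → ℤ := fun e => h e - h (e - 1)

lemma nab_neg (h : ℤ → ℤ) : nab (-h) = - nab h := by
  funext e; simp only [nab, Pi.neg_apply]; ring

lemma nab_it_neg (q : ℕ) (h : ℤ → ℤ) : nab^[q] (-h) = - nab^[q] h := by
  induction q generalizing h with
  | zero => rfl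
  | succ q ih => rw [Function.iterate_succ_apply, nab_neg, ih, Function.iterate_succ_apply]

lemma nab_sum (q : ℕ) (h : ℤ → ℤ) (e : ℤ) : 
    nab^[q] h e = ∑ s ∈ Finset.range (q+1), (-1 : ℤ) ^ s * (q.choose s : ℤ) * h (e - s) := by
  induction q generalizing h with
  | zero => simp
  | succ q ih =>
    rw [Function.iterate_succ_apply, ih]
    unfold nab
    rw [Finset.sum_range_succ' _ (q+1)]
    simp only [mul_sub, Finset.sum_sub_distrib]
    have h1 : ∑ s ∈ Finset.range (q + 1), (-1 : ℤ) ^ s * (q.choose s : ℤ) * h (e - s) = 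
       (∑ s ∈ Finset.range (q + 1), (-1 : ℤ) ^ (s+1) * (q.choose (s+1) : ℤ) * h (e - (s + 1 : ℕ))) + h e := by
      rw [Finset.sum_range_succ', Finset.sum_range_succ _ q]
      simp
    rw [h1, add_sub_right_comm, ← Finset.sum_sub_distrib]
    congr 1
    · apply Finset.sum_congr rfl
      intro s _
      rw [Nat.choose_succ_succ]
      push_cast
      rw [pow_succ, sub_sub]
      ring
    · simp

theorem main_ind [Infinite k] (q : ℕ) : ∀ Q : GM k n, Module.Finite (MvPolynomial (Fin n) k) Q.V → 
    Dep (irrIdeal k n) q Q.V → mDim (MvPolynomial (Fin n) k) Q.V ≤ (q : WithBot ℕ∞) → Q.fd → 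
    ∃ V : GM k n, Tower q Q V ∧ V.BddAbv ∧ V.fd ∧ ∀ e, (-1) ^ q * nab^[q] V.hf e = nab^[q] Q.hf e := by
  induction q with
  | zero =>
    intro Q _ hdep hdim hfd
    have := artin_of_dim Q.V hdim
    exact ⟨Q, Tower.nil Q, Q.bddAbv_of_artinian, hfd, by simp⟩
  | succ q ih =>
    intro Q _ hdep hdim hfd
    obtain ⟨a, ha⟩ := exists_linForm hdep
    have hh := linForm_homog a
    have hm := linForm_mem a
    generalize linForm k n a = x at *
    have hdimK : mDim (MvPolynomial (Fin n) k) (QuotSMulTop x Q.V) ≤ (q : WithBot ℕ∞) := by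
      have h1 : Module.supportDim (MvPolynomial (Fin n) k) (QuotSMulTop x Q.V) + 1 ≤ 
          Module.supportDim (MvPolynomial (Fin n) k) Q.V := 
        Module.supportDim_quotSMulTop_succ_le_of_notMem_minimalPrimes
          (fun p hp => ha.notMem_of_mem_minimalPrimes hp)
      have h2 : ((q + 1 : ℕ) : WithBot ℕ∞) < ((q + 1 + 1 : ℕ) : WithBot ℕ∞) := by
        exact_mod_cast Nat.lt_succ_self (q + 1)
      have h3 := (h1.trans hdim).trans_lt h2
      rw [Nat.cast_succ (q + 1)] at h3
      exact wb_lt _ _ (lt_of_add_lt_add_right h3)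
    obtain ⟨K', hT, hb, hf, hnab⟩ := ih (KQ Q hh) (inferInstanceAs (Module.Finite _ (QuotSMulTop x Q.V))) 
      (hdep.quot _ ha) hdimK (KK_fd Q hh hfd)
    have hD := DGD Q hh hm ha
    obtain ⟨D', hT', ⟨ht⟩⟩ := hT.trip _ (KK_trip Q hh hD)
    have hb' := ht.bdd hh hb
    have hf' := ht.fdD hh hf hb'
    refine ⟨D', Tower.cons q x Q _ D' hh hm ha ⟨hD⟩ hT', hb', hf', fun e => ?_⟩
    have e1 : K'.hf = - nab D'.hf := funext fun e => ht.hfD hh hf' e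
    have e2 : (KQ Q hh).hf = nab Q.hf := funext fun e => KK_hf Q hh ha hfd e
    have := hnab e
    rw [e1, e2, nab_it_neg] at this
    rw [Function.iterate_succ_apply, Function.iterate_succ_apply, ← this, Pi.neg_apply, pow_succ]
    ring

end St15
end


noncomputable section
namespace St15
open Limits
open scoped Pointwise
set_option linter.unusedVariables false
set_option linter.unusedSectionVars false
set_option linter.style.haveILetI false
set_option linter.unusedSimpArgs false

lemma dep_sub {R : Type} [CommRing R] (m : Ideal R) (q : ℕ) (Q : Type) [AddCommGroup Q] [Module R Q] 
    (h : Subsingleton Q) : Dep m q Q := by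
  intro j hj
  refine subsingleton_of_forall_eq 0 fun x => ?_
  have hz : 𝟙 (ModuleCat.of R Q) = 0 := by
    ext v
    exact Subsingleton.elim (α := Q) _ _
  have := Abelian.Ext.comp_mk₀_id x
  rw [← this, hz, Abelian.Ext.mk₀_zero, Abelian.Ext.comp_zero]

section rep
variable {k : Type} [Field k] {n : ℕ} (V : GM k n)

lemma pi_coe (e : ℤ) (x : DirectSum ℤ fun e => V.piece e) : 
    V.π e (DirectSum.coeAddMonoidHom V.piece x) = x e := by
  classical
  induction x using DirectSum.induction_on with
  | zero => simp
  | of i v =>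
    rw [DirectSum.coeAddMonoidHom_of]
    by_cases h : i = e
    · subst h
      rw [DirectSum.of_eq_same]
      exact v.2
    · rw [DirectSum.of_eq_of_ne _ _ _ (Ne.symm h)]
      rw [← GM.mem_piece.1 v.2, V.orth _ _ _ (Ne.symm h)]
      rfl
  | add x y hx hy => rw [map_add, map_add, hx, hy]; rfl

lemma piece_internal : DirectSum.IsInternal V.piece := by
  classical
  constructor
  · rw [injective_iff_map_eq_zero]
    intro x hx
    apply DFinsupp.ext
    intro e
    apply Subtype.ext
    have := pi_coe V e x
    rw [hx, map_zero] at this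
    exact this.symm
  · intro v
    obtain ⟨s, hs⟩ := V.fin v
    refine ⟨∑ e ∈ s, DirectSum.of (fun e => V.piece e) e ⟨V.π e v, V.idem _ _⟩, ?_⟩
    rw [map_sum]
    refine Eq.trans ?_ hs
    apply Finset.sum_congr rfl
    intro e _
    rw [DirectSum.coeAddMonoidHom_of]

def rep (hfd : V.fd) {N : Type} [AddCommGroup N] [Module (MvPolynomial (Fin n) k) N] 
    (iso : V.V ≃ₗ[MvPolynomial (Fin n) k] N) : GradedRep k n N where
  V := V.V
  iso := iso
  piece := V.piece
  internal := piece_internal V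
  compat d f hf e x hx := by
    change V.π _ _ = _
    rw [V.compat d f hf]
    exact congrArg _ hx
  findim := hfd
  hdim e := Module.finrank k (V.piece e)
  hdim_spec e := rfl
end rep

section mg
variable {k : Type} [Field k] {n : ℕ}
    {M : Type} [AddCommGroup M] [Module (MvPolynomial (Fin n) k) M] [Module k M]
    [IsScalarTower k (MvPolynomial (Fin n) k) M] 
    (𝒜 : ℤ → Submodule k M) (hinternal : DirectSum.IsInternal 𝒜)
    (hcompat : ∀ (e : ℕ) (f : MvPolynomial (Fin n) k), f.IsHomogeneous e →
      ∀ (d' : ℤ), ∀ x ∈ 𝒜 d', f • x ∈ 𝒜 (d' + (e : ℤ)))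

open Classical in
def mpi (e : ℤ) : M →+ M := 
  letI := hinternal.chooseDecomposition 𝒜
  { toFun := fun v => (DirectSum.decompose 𝒜 v e : M)
    map_zero' := by simp
    map_add' := by intro a b; simp }

lemma mpi_same {e : ℤ} {v : M} (h : v ∈ 𝒜 e) : mpi 𝒜 hinternal e v = v := by
  classical
  letI := hinternal.chooseDecomposition 𝒜
  exact DirectSum.decompose_of_mem_same 𝒜 h

lemma mpi_ne {e e' : ℤ} {v : M} (h : v ∈ 𝒜 e) (hne : e ≠ e') : mpi 𝒜 hinternal e' v = 0 := by
  classical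
  letI := hinternal.chooseDecomposition 𝒜
  exact DirectSum.decompose_of_mem_ne 𝒜 h hne

lemma mpi_mem (e : ℤ) (v : M) : mpi 𝒜 hinternal e v ∈ 𝒜 e := by
  classical
  letI := hinternal.chooseDecomposition 𝒜
  exact (DirectSum.decompose 𝒜 v e).2

def MG : GM k n where
  V := M
  π := mpi 𝒜 hinternal
  idem e v := mpi_same 𝒜 hinternal (mpi_mem _ _ _ _)
  orth e e' v h := mpi_ne 𝒜 hinternal (mpi_mem _ _ _ _) h.symm
  fin v := by
    classical
    letI := hinternal.chooseDecomposition 𝒜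
    exact ⟨_, DirectSum.sum_support_decompose 𝒜 v⟩
  compat d f hf e v := by
    classical
    letI := hinternal.chooseDecomposition 𝒜
    induction v using DirectSum.Decomposition.inductionOn 𝒜 with
    | zero => simp
    | @homogeneous i m =>
      have h1 := hcompat d f hf i m m.2
      by_cases h : i = e
      · subst h
        rw [mpi_same 𝒜 hinternal h1, mpi_same 𝒜 hinternal m.2]
      · rw [mpi_ne 𝒜 hinternal h1 (by omega), mpi_ne 𝒜 hinternal m.2 h, smul_zero]
    | add a b ha hb => rw [smul_add, map_add, map_add, ha, hb, smul_add]

lemma gr_stable {P : Submodule (MvPolynomial (Fin n) k) M} (hP : IsGradedSub k n M 𝒜 P) : 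
    ∀ e, ∀ v ∈ P, mpi 𝒜 hinternal e v ∈ P := by
  intro e v hv
  have h1 := hP (show v ∈ P.restrictScalars k from hv)
  clear hv
  induction h1 using Submodule.iSup_induction' with
  | mem i w hw =>
    by_cases h : i = e
    · subst h
      rw [mpi_same 𝒜 hinternal hw.2]; exact hw.1
    · rw [mpi_ne 𝒜 hinternal hw.2 h]; exact zero_mem _
  | zero => rw [map_zero]; exact zero_mem _
  | add a b ha hb iha ihb => rw [map_add]; exact add_mem iha ihb

def SG {P : Submodule (MvPolynomial (Fin n) k) M} (hP : IsGradedSub k n M 𝒜 P) : GM k n := 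
  (MG 𝒜 hinternal hcompat).sub P (gr_stable 𝒜 hinternal hP)

def SG_equiv {P : Submodule (MvPolynomial (Fin n) k) M} (hP : IsGradedSub k n M 𝒜 P) (e : ℤ) : 
    (SG 𝒜 hinternal hcompat hP).piece e ≃ₗ[k] ↥(P.restrictScalars k ⊓ 𝒜 e) where
  toFun v := ⟨(show P from v.1).1, (show P from v.1).2, by
    have := congrArg (fun w : P => w.1) v.2
    rw [← show mpi 𝒜 hinternal e (show P from v.1).1 = (show P from v.1).1 from this]
    exact mpi_mem _ _ _ _⟩
  invFun v := ⟨(show P from ⟨v.1, v.2.1⟩), Subtype.ext (mpi_same 𝒜 hinternal v.2.2)⟩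
  left_inv v := rfl
  right_inv v := rfl
  map_add' v w := rfl
  map_smul' a v := Subtype.ext (algebraMap_smul (MvPolynomial (Fin n) k) a (show P from v.1).1)

end mg

section fin
variable (k : Type) [Field k] (n : ℕ)
    (M : Type) [AddCommGroup M] [Module (MvPolynomial (Fin n) k) M] [Module k M]
    [IsScalarTower k (MvPolynomial (Fin n) k) M] [Module.Finite (MvPolynomial (Fin n) k) M]
    (𝒜 : ℤ → Submodule k M) (hinternal : DirectSum.IsInternal 𝒜)
    (hcompat : ∀ (e : ℕ) (f : MvPolynomial (Fin n) k), f.IsHomogeneous e →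
      ∀ (d' : ℤ), ∀ x ∈ 𝒜 d', f • x ∈ 𝒜 (d' + (e : ℤ)))
    (hfd : ∀ e : ℤ, FiniteDimensional k (𝒜 e))

abbrev B1 (j : ℕ) : GM k n := SG 𝒜 hinternal hcompat (dl_mem k n M 𝒜 j).1
abbrev A1 (j : ℕ) : GM k n := SG 𝒜 hinternal hcompat (dlp_mem k n M 𝒜 j).1

def C1 (j : ℕ) : GM k n := (B1 k n M 𝒜 hinternal hcompat j).quot 
  (Submodule.comap (dl k n M 𝒜 j).subtype (dlp k n M 𝒜 j)) 
  (fun e v hv => gr_stable 𝒜 hinternal (dlp_mem k n M 𝒜 j).1 e _ hv)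

def f1 (j : ℕ) : (A1 k n M 𝒜 hinternal hcompat j).V →ₗ[MvPolynomial (Fin n) k] (B1 k n M 𝒜 hinternal hcompat j).V := 
  (Submodule.inclusion (dlp_le k n M 𝒜 j) : 
    ↥(dlp k n M 𝒜 j) →ₗ[MvPolynomial (Fin n) k] ↥(dl k n M 𝒜 j))

def g1 (j : ℕ) : (B1 k n M 𝒜 hinternal hcompat j).V →ₗ[MvPolynomial (Fin n) k] (C1 k n M 𝒜 hinternal hcompat j).V := 
  Submodule.mkQ (Submodule.comap (dl k n M 𝒜 j).subtype (dlp k n M 𝒜 j))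

lemma g1_surj (j : ℕ) : Function.Surjective (g1 k n M 𝒜 hinternal hcompat j) := 
  Submodule.mkQ_surjective (Submodule.comap (dl k n M 𝒜 j).subtype (dlp k n M 𝒜 j))

lemma f1_inj (j : ℕ) : Function.Injective (f1 k n M 𝒜 hinternal hcompat j) := 
  Submodule.inclusion_injective (dlp_le k n M 𝒜 j)

include hfd in
lemma B1_fd (j : ℕ) : (B1 k n M 𝒜 hinternal hcompat j).fd := by
  intro e
  have := hfd e
  have : Module.Finite k ↥((dl k n M 𝒜 j).restrictScalars k ⊓ 𝒜 e) := 
    Submodule.finiteDimensional_of_le inf_le_right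
  exact Module.Finite.equiv (SG_equiv 𝒜 hinternal hcompat (dl_mem k n M 𝒜 j).1 e).symm

lemma g1_zero (j : ℕ) (v : dl k n M 𝒜 j) : g1 k n M 𝒜 hinternal hcompat j v = 0 ↔ v.1 ∈ dlp k n M 𝒜 j := 
  Submodule.Quotient.mk_eq_zero _

include hfd in
lemma C1_fd (j : ℕ) : (C1 k n M 𝒜 hinternal hcompat j).fd := fun e =>
  ses_fin_c (g1 k n M 𝒜 hinternal hcompat j) e e (g1_surj k n M 𝒜 hinternal hcompat j) (fun v => rfl) 
    (B1_fd k n M 𝒜 hinternal hcompat hfd j e)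

include hfd in
lemma C1_hf (j : ℕ) (e : ℤ) : (C1 k n M 𝒜 hinternal hcompat j).hf e = 
    (Module.finrank k ↥((dl k n M 𝒜 j).restrictScalars k ⊓ 𝒜 e) : ℤ) - 
    (Module.finrank k ↥((dlp k n M 𝒜 j).restrictScalars k ⊓ 𝒜 e) : ℤ) := by
  have := ses_rank (f1 k n M 𝒜 hinternal hcompat j) (g1 k n M 𝒜 hinternal hcompat j) e e e
    (f1_inj k n M 𝒜 hinternal hcompat j) (g1_surj k n M 𝒜 hinternal hcompat j) 
    (fun v => (g1_zero k n M 𝒜 hinternal hcompat j _).2 (show dlp k n M 𝒜 j from v).2)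
    (fun v hv => ⟨(⟨(show dl k n M 𝒜 j from v).1, (g1_zero k n M 𝒜 hinternal hcompat j v).1 hv⟩ : dlp k n M 𝒜 j), rfl⟩)
    (fun v => rfl) (fun v => rfl) (B1_fd k n M 𝒜 hinternal hcompat hfd j e)
  rw [(SG_equiv 𝒜 hinternal hcompat (dl_mem k n M 𝒜 j).1 e).finrank_eq,
    (SG_equiv 𝒜 hinternal hcompat (dlp_mem k n M 𝒜 j).1 e).finrank_eq] at this
  unfold GM.hf
  omega

end fin
end St15
end
/-- Let `R = k[x_1, …, x_n]` (`k` infinite), `M` a finitely generated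
ℤ-graded `R`-module of dimension `d` with dimension filtration `{δ_j}` (by largest graded
submodules of dimension `≤ j`), and `0 ≤ i ≤ d`.  If `M` is `i`-partially sequentially
Cohen-Macaulay, then for all `j ≥ i`:
(1) `H^j_𝔪(M) ≅ H^j_𝔪(δ_j) ≅ H^j_𝔪(δ_j/δ_{j-1})`; and
(2) `(z-1)^j · Hilb(H^j_𝔪(M)) = (1-z)^j · Hilb(δ_j/δ_{j-1})`, stated coefficientwise (in each
degree `e ∈ ℤ`) via a graded presentation of `H^j_𝔪(M)`; the degree-`e` piece of
`δ_j/δ_{j-1}` has dimension `dim (δ_j ∩ 𝒜 e) - dim (δ_{j-1} ∩ 𝒜 e)`. -/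
theorem stmt15 (k : Type) [Field k] [Infinite k] (n : ℕ)
    (M : Type) [AddCommGroup M] [Module (MvPolynomial (Fin n) k) M] [Module k M]
    [IsScalarTower k (MvPolynomial (Fin n) k) M] [Module.Finite (MvPolynomial (Fin n) k) M]
    (𝒜 : ℤ → Submodule k M) (hinternal : DirectSum.IsInternal 𝒜)
    (hcompat : ∀ (e : ℕ) (f : MvPolynomial (Fin n) k), f.IsHomogeneous e →
      ∀ (d' : ℤ), ∀ x ∈ 𝒜 d', f • x ∈ 𝒜 (d' + (e : ℤ)))
    (hfd : ∀ e : ℤ, FiniteDimensional k (𝒜 e))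
    (d : ℕ) (hd : mDim (MvPolynomial (Fin n) k) M = (d : WithBot ℕ∞))
    (i : ℕ) (hi : i ≤ d)
    (hscm : IsPartiallySCM k n M 𝒜 ⊥ i) :
    ∀ j : ℕ, i ≤ j →
      Nonempty (locCoh k n j M ≃ₗ[MvPolynomial (Fin n) k]
        locCoh k n j ↥(deltaPairG k n M 𝒜 ⊥ j)) ∧
      Nonempty (locCoh k n j ↥(deltaPairG k n M 𝒜 ⊥ j) ≃ₗ[MvPolynomial (Fin n) k]
        locCoh k n j
          (subQuot (MvPolynomial (Fin n) k)
            (deltaPairGPred k n M 𝒜 ⊥ j) (deltaPairG k n M 𝒜 ⊥ j))) ∧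
      ∃ G : GradedRep k n (locCoh k n j M),
        ∀ e : ℤ,
          (∑ s ∈ Finset.range (j + 1),
            ((-1 : ℤ) ^ (j - s) * (j.choose s : ℤ) * (G.hdim (e - (s : ℤ)) : ℤ))) =
          (∑ s ∈ Finset.range (j + 1),
            ((-1 : ℤ) ^ s * (j.choose s : ℤ) *
              ((Module.finrank k
                  ↥((deltaPairG k n M 𝒜 ⊥ j).restrictScalars k ⊓ 𝒜 (e - (s : ℤ))) : ℤ) -
               (Module.finrank k
                  ↥((deltaPairGPred k n M 𝒜 ⊥ j).restrictScalars k ⊓ 𝒜 (e - (s : ℤ))) : ℤ)))) := by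
  intro j hj
  obtain ⟨I1⟩ := St15.iso1 k n M 𝒜 hinternal d hd i hscm j hj
  have I2 := St15.iso2 k n M 𝒜 j
  have l1 := St15.locEquiv (irrIdeal k n) M j
  have l2 := St15.locEquiv (irrIdeal k n) (deltaPairG k n M 𝒜 ⊥ j) j
  have l3 := St15.locEquiv (irrIdeal k n) (St15.Qd k n M 𝒜 j) j
  refine ⟨⟨(l1.trans I1).trans l2.symm⟩, ⟨(l2.trans I2).trans l3.symm⟩, ?_⟩
  have hdep : St15.Dep (irrIdeal k n) j (St15.Qd k n M 𝒜 j) := by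
    rcases hscm j hj with h | h
    · exact St15.dep_sub _ _ _ h
    · exact St15.Qd_dep k n M 𝒜 j h
  obtain ⟨V, hT, hb, hf, hnab⟩ := St15.main_ind j (St15.C1 k n M 𝒜 hinternal hcompat j)
    (inferInstanceAs (Module.Finite _ (St15.Qd k n M 𝒜 j))) hdep (St15.Qd_dim k n M 𝒜 j)
    (St15.C1_fd k n M 𝒜 hinternal hcompat hfd j)
  obtain ⟨I3⟩ := hT.ss
  have I3' : St15.SS (irrIdeal k n) (St15.Qd k n M 𝒜 j) j ≃ₗ[MvPolynomial (Fin n) k] 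
    St15.SS (irrIdeal k n) V.V 0 := I3
  have I4 := St15.evE (irrIdeal k n) (St15.GM.BddAbv.isTor V hb)
  refine ⟨St15.rep V hf (((l1.trans I1).trans (I2.trans (I3'.trans I4))).symm), fun e => ?_⟩
  have h1 := hnab e
  rw [St15.nab_sum, St15.nab_sum] at h1
  simp only [St15.C1_hf k n M 𝒜 hinternal hcompat hfd] at h1
  refine Eq.trans ?_ h1
  rw [Finset.mul_sum]
  apply Finset.sum_congr rfl
  intro s hs
  have hs' : s ≤ j := by have := Finset.mem_range.1 hs; omega
  have e1 : (-1 : ℤ) ^ j = (-1) ^ (j - s) * (-1) ^ s := by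
    rw [← pow_add]; congr 1; omega
  have e2 : (-1 : ℤ) ^ s * (-1) ^ s = 1 := by rw [← mul_pow]; simp
  change (-1 : ℤ) ^ (j - s) * (j.choose s : ℤ) * V.hf (e - s) = _
  rw [e1]
  linear_combination (-(-1 : ℤ) ^ (j - s) * (j.choose s : ℤ) * V.hf (e - s)) * e2
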